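/- arXiv:2406.02712 — 2 statements merged into one kernel-verified Lean document; each statement's English description precedes it below -/
import Mathlib

section
/- Let S ∈ 𝒳 be fixed and let U : 𝒳 → ℝ be a law-invariant and positively homogeneous monetary utility. Then there exists a convex set 𝒯 of convex distortion functions, sequentially closed under pointwise convergence, such that for all Z ∈ 𝒳↑ (random variables comonotone with S) one has U(Z) = inf_{T∈𝒯} ∫ Z d(T∘ℙ). -/
open MeasureTheory ProbabilityTheory Filter

noncomputable section

variable {Ω : Type*} [MeasurableSpace Ω] (μ : MeasureTheory.Measure Ω) [MeasureTheory.IsProbabilityMeasure μ]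

/-- The measure is atomless: every set of positive measure has a subset of strictly
smaller positive measure. -/
def AtomlessMeasure : Prop :=
  ∀ s : Set Ω, MeasurableSet s → μ s ≠ 0 →
    ∃ t ⊆ s, MeasurableSet t ∧ 0 < μ t ∧ μ t < μ s

/-- The space `𝒳 = L^∞` of essentially bounded random variables. -/
abbrev Xinf : Type _ := Lp ℝ ⊤ μ

variable {μ}

/-- Monotone utility functional on `L^∞`. -/
def UMonotone (U : Xinf μ → ℝ) : Prop :=
  ∀ Z₁ Z₂ : Xinf μ, Z₁ ≤ Z₂ → U Z₁ ≤ U Z₂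

/-- Translation invariance. -/
def TranslationInvariant (U : Xinf μ → ℝ) : Prop :=
  ∀ (Z : Xinf μ) (c : ℝ), U (Z + Lp.const ⊤ μ c) = U Z + c

/-- Law invariance. -/
def LawInvariant (U : Xinf μ → ℝ) : Prop :=
  ∀ Z₁ Z₂ : Xinf μ, IdentDistrib (Z₁ : Ω → ℝ) (Z₂ : Ω → ℝ) μ μ → U Z₁ = U Z₂

/-- Positive homogeneity. -/
def PositivelyHomogeneous (U : Xinf μ → ℝ) : Prop :=
  ∀ (Z : Xinf μ) (t : ℝ), 0 ≤ t → U (t • Z) = t * U Z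

/-- Concave order `Z₁ ⪯_ccv Z₂`. -/
def ConcaveOrder (Z₁ Z₂ : Xinf μ) : Prop :=
  ∀ φ : ℝ → ℝ, ConcaveOn ℝ Set.univ φ →
    ∫ ω, φ (Z₁ ω) ∂μ ≤ ∫ ω, φ (Z₂ ω) ∂μ

/-- Strict concave order `Z₁ ≺_ccv Z₂`. -/
def StrictConcaveOrder (Z₁ Z₂ : Xinf μ) : Prop :=
  ConcaveOrder Z₁ Z₂ ∧
    ∀ φ : ℝ → ℝ, StrictConcaveOn ℝ Set.univ φ →
      ∫ ω, φ (Z₁ ω) ∂μ < ∫ ω, φ (Z₂ ω) ∂μ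

/-- Increasing concave order `Z₁ ⪯_icv Z₂`. -/
def IncConcaveOrder (Z₁ Z₂ : Xinf μ) : Prop :=
  ∀ φ : ℝ → ℝ, Monotone φ → ConcaveOn ℝ Set.univ φ →
    ∫ ω, φ (Z₁ ω) ∂μ ≤ ∫ ω, φ (Z₂ ω) ∂μ

/-- Strict increasing concave order `Z₁ ≺_icv Z₂`. -/
def StrictIncConcaveOrder (Z₁ Z₂ : Xinf μ) : Prop :=
  IncConcaveOrder Z₁ Z₂ ∧
    ∀ φ : ℝ → ℝ, Monotone φ → StrictConcaveOn ℝ Set.univ φ →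
      ∫ ω, φ (Z₁ ω) ∂μ < ∫ ω, φ (Z₂ ω) ∂μ

/-- Schur concavity. -/
def SchurConcave (U : Xinf μ → ℝ) : Prop :=
  ∀ Z₁ Z₂ : Xinf μ, ConcaveOrder Z₁ Z₂ → U Z₁ ≤ U Z₂

/-- Strict Schur concavity. -/
def StrictSchurConcave (U : Xinf μ → ℝ) : Prop :=
  ∀ Z₁ Z₂ : Xinf μ, StrictConcaveOrder Z₁ Z₂ → U Z₁ < U Z₂

/-- S.S.D. preserving. -/
def SSDPreserving (U : Xinf μ → ℝ) : Prop :=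
  ∀ Z₁ Z₂ : Xinf μ, IncConcaveOrder Z₁ Z₂ → U Z₁ ≤ U Z₂

/-- Strictly S.S.D. preserving. -/
def StrictSSDPreserving (U : Xinf μ → ℝ) : Prop :=
  ∀ Z₁ Z₂ : Xinf μ, StrictIncConcaveOrder Z₁ Z₂ → U Z₁ < U Z₂

/-- A tuple of (pointwise defined) random variables is comonotone. -/
def ComonotoneFun {n : ℕ} (Z : Fin n → Ω → ℝ) : Prop :=
  ∀ i j ω₁ ω₂, 0 ≤ (Z i ω₁ - Z i ω₂) * (Z j ω₁ - Z j ω₂)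

/-- A tuple of elements of `L^∞` is comonotone if some choice of representatives is. -/
def ComonotoneLp {n : ℕ} (Y : Fin n → Xinf μ) : Prop :=
  ∃ Z : Fin n → Ω → ℝ, (∀ i, (Y i : Ω → ℝ) =ᵐ[μ] Z i) ∧ ComonotoneFun Z

/-- Assumption 1 of the paper. -/
def Assumption1 {n : ℕ} (U : Fin n → Xinf μ → ℝ) : Prop :=
  ∀ i (Z : Xinf μ),
    Continuous (fun c : ℝ => U i (Z + Lp.const ⊤ μ c)) ∧
    StrictMono (fun c : ℝ => U i (Z + Lp.const ⊤ μ c)) ∧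
    Tendsto (fun c : ℝ => U i (Z + Lp.const ⊤ μ c)) atTop atTop

section Alloc

variable {n : ℕ} (U : Fin n → Xinf μ → ℝ) (X : Fin n → Xinf μ)

/-- Allocations of the aggregate endowment `∑ i, X i`. -/
def Alloc : Set (Fin n → Xinf μ) := {Y | ∑ i, Y i = ∑ i, X i}

/-- Individually rational allocations. -/
def IRset : Set (Fin n → Xinf μ) :=
  {Y | Y ∈ Alloc X ∧ ∀ i, U i (X i) ≤ U i (Y i)}

/-- Pareto-optimal allocations. -/
def POset : Set (Fin n → Xinf μ) :=
  {Y | Y ∈ IRset U X ∧ ¬∃ Y' ∈ IRset U X,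
    (∀ i, U i (Y i) ≤ U i (Y' i)) ∧ ∃ j, U j (Y j) < U j (Y' j)}

/-- Weakly Pareto-optimal allocations. -/
def WeakPOset : Set (Fin n → Xinf μ) :=
  {Y | Y ∈ IRset U X ∧ ¬∃ Y' ∈ IRset U X, ∀ i, U i (Y i) < U i (Y' i)}

/-- Comonotone allocations. -/
def AllocC : Set (Fin n → Xinf μ) := {Y | Y ∈ Alloc X ∧ ComonotoneLp Y}

/-- Comonotone Pareto-optimal allocations. -/
def CPOset : Set (Fin n → Xinf μ) :=
  {Y | Y ∈ IRset U X ∧ ComonotoneLp Y ∧ ¬∃ Y' ∈ IRset U X, ComonotoneLp Y' ∧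
    (∀ i, U i (Y i) ≤ U i (Y' i)) ∧ ∃ j, U j (Y j) < U j (Y' j)}

/-- Maximizers of the `λ`-weighted sum of utilities over IR allocations. -/
def SmaxSet (lam : Fin n → ℝ) : Set (Fin n → Xinf μ) :=
  {Y | Y ∈ IRset U X ∧ ∀ Y' ∈ IRset U X,
    ∑ i, lam i * U i (Y' i) ≤ ∑ i, lam i * U i (Y i)}

/-- Maximizers of the `λ`-weighted sum of utilities over IR comonotone allocations. -/
def CSmaxSet (lam : Fin n → ℝ) : Set (Fin n → Xinf μ) :=
  {Y | Y ∈ IRset U X ∧ ComonotoneLp Y ∧ ∀ Y' ∈ IRset U X, ComonotoneLp Y' →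
    ∑ i, lam i * U i (Y' i) ≤ ∑ i, lam i * U i (Y i)}

end Alloc



/-- A distortion function: a nondecreasing map of `[0,1]` into `[0,1]` with
`T 0 = 0` and `T 1 = 1` (encoded as a function on `ℝ`; only values on `[0,1]` matter). -/
def IsDistortion (T : ℝ → ℝ) : Prop :=
  MonotoneOn T (Set.Icc 0 1) ∧ (∀ x ∈ Set.Icc (0:ℝ) 1, T x ∈ Set.Icc (0:ℝ) 1) ∧
    T 0 = 0 ∧ T 1 = 1

/-- A convex distortion function. -/
def IsConvexDistortion (T : ℝ → ℝ) : Prop :=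
  IsDistortion T ∧ ConvexOn ℝ (Set.Icc 0 1) T

/-- A concave distortion function. -/
def IsConcaveDistortion (T : ℝ → ℝ) : Prop :=
  IsDistortion T ∧ ConcaveOn ℝ (Set.Icc 0 1) T

/-- Sequential closedness under pointwise convergence. -/
def SeqClosedPointwise (𝒯 : Set (ℝ → ℝ)) : Prop :=
  ∀ (T : ℕ → ℝ → ℝ) (T' : ℝ → ℝ), (∀ k, T k ∈ 𝒯) →
    (∀ x, Tendsto (fun k => T k x) atTop (nhds (T' x))) → T' ∈ 𝒯

/-- The Choquet integral `∫ Z d(T ∘ μ)` of a random variable `Z` with respect to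
the capacity `T ∘ μ`. -/
def choquet (μ : Measure Ω) (T : ℝ → ℝ) (Z : Ω → ℝ) : ℝ :=
  (∫ t in Set.Ioi (0:ℝ), T (μ {ω | t < Z ω}).toReal) +
    ∫ t in Set.Iio (0:ℝ), (T (μ {ω | t < Z ω}).toReal - 1)

/-- Choquet integral of an element of `L^∞`. -/
def choquetLp (μ : Measure Ω) [IsProbabilityMeasure μ] (T : ℝ → ℝ) (Z : Lp ℝ ⊤ μ) : ℝ :=
  choquet μ T (Z : Ω → ℝ)

/-- The set `𝒢` of tuples of nondecreasing nonnegative functions on `ℝ₊` summing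
to the identity. -/
def Gset (n : ℕ) : Set (Fin n → ℝ → ℝ) :=
  {g | (∀ i, MonotoneOn (g i) (Set.Ici 0)) ∧ (∀ i, ∀ x ≥ (0:ℝ), 0 ≤ g i x) ∧
    ∀ x ≥ (0:ℝ), ∑ i, g i x = x}

/-- A pair of random variables is comonotone. -/
def ComonotonePair (Z S : Ω → ℝ) : Prop :=
  ∀ ω₁ ω₂, 0 ≤ (Z ω₁ - Z ω₂) * (S ω₁ - S ω₂)

def ComonotonePairLp (Z S : Lp ℝ ⊤ μ) : Prop :=
  ∃ Z' S' : Ω → ℝ, (Z : Ω → ℝ) =ᵐ[μ] Z' ∧ (S : Ω → ℝ) =ᵐ[μ] S' ∧ ComonotonePair Z' S'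



/-- The essential infimum `s̲` of an element of `L^∞`. -/
def essInfS (S : Lp ℝ ⊤ μ) : ℝ := essInf (S : Ω → ℝ) μ

/-- The tail probability `ℙ(S > s̲ + x)`. -/
def tailProbS (S : Lp ℝ ⊤ μ) (x : ℝ) : ℝ :=
  (μ {ω | essInfS S + x < S ω}).toReal

/-- The objective `(T_1,…,T_n) ↦ ∫_0^∞ max_i T_i(ℙ(S > s̲ + x)) dx`. -/
def JobjS {n : ℕ} (S : Lp ℝ ⊤ μ) (T : Fin n → ℝ → ℝ) : ℝ :=
  ∫ x in Set.Ioi (0:ℝ), ⨆ i, T i (tailProbS S x)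

open Classical in
/-- The set `L_x` of agents attaining the maximum `max_j T_j(ℙ(S > s̲ + x))`. -/
def Lset {n : ℕ} (S : Lp ℝ ⊤ μ) (T : Fin n → ℝ → ℝ) (x : ℝ) : Finset (Fin n) :=
  Finset.univ.filter (fun i => T i (tailProbS S x) = ⨆ j, T j (tailProbS S x))


set_option linter.unusedSectionVars false

/-- In an atomless probability space there is a nested family of events of every probability. -/
theorem AtomlessMeasure.exists_nested_events (h : AtomlessMeasure μ) :
    ∃ A : ℝ → Set Ω, (∀ r ∈ Set.Icc (0 : ℝ) 1, MeasurableSet (A r) ∧ μ.real (A r) = r) ∧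
      ∀ r ∈ Set.Icc (0 : ℝ) 1, ∀ s ∈ Set.Icc (0 : ℝ) 1, r < s → A r ⊆ A s := by
  let R : {A : Set Ω // MeasurableSet A} → {A : Set Ω // MeasurableSet A} → Prop :=
    fun A B => A.1 ⊆ B.1 ∧ μ.real A.1 < μ.real B.1
  have h0 : IsChain R {⟨∅, .empty⟩, ⟨Set.univ, .univ⟩} := by
    refine IsChain.insert (by simp [IsChain]) ?_
    rintro b rfl -
    left
    simp [R]
  obtain ⟨C, hC, h0C⟩ := h0.exists_maxChain
  have hmem : ∀ X, (∀ B ∈ C, B ≠ X → R B X ∨ R X B) → X ∈ C := by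
    intro X hX
    have := hC.2 (hC.1.insert (a := X) fun B hB hne => (hX B hB hne.symm).symm)
      (Set.subset_insert X C)
    rw [this]
    exact Set.mem_insert _ _
  have hemp : (⟨∅, .empty⟩ : {A : Set Ω // MeasurableSet A}) ∈ C := h0C (by simp)
  have huniv : (⟨Set.univ, .univ⟩ : {A : Set Ω // MeasurableSet A}) ∈ C := h0C (by simp)
  have hlt : ∀ X ∈ C, ∀ Y ∈ C, μ.real X.1 < μ.real Y.1 → X.1 ⊆ Y.1 := by
    intro X hX Y hY hXY
    have hne : X ≠ Y := by rintro rfl; exact lt_irrefl _ hXY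
    rcases hC.1 hX hY hne with h | h
    · exact h.1
    · exact absurd h.2 hXY.not_gt
  have hle : ∀ X ∈ C, ∀ Y ∈ C, μ.real X.1 ≤ μ.real Y.1 → X.1 ⊆ Y.1 := by
    intro X hX Y hY hXY
    by_cases hne : X = Y
    · rw [hne]
    rcases hC.1 hX hY hne with h | h
    · exact h.1
    · exact absurd h.2 hXY.not_gt
  have hlow : ∀ r ∈ Set.Icc (0 : ℝ) 1, ∃ X ∈ C, μ.real X.1 ≤ r ∧
      ∀ Y ∈ C, μ.real Y.1 ≤ r → μ.real Y.1 ≤ μ.real X.1 := by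
    intro r hr
    let S : Set ℝ := {x | ∃ X ∈ C, μ.real X.1 = x ∧ x ≤ r}
    have hSne : S.Nonempty := ⟨0, _, hemp, by simp, hr.1⟩
    have hSb : BddAbove S := ⟨r, by rintro x ⟨-, -, -, hx⟩; exact hx⟩
    have har : sSup S ≤ r := csSup_le hSne (by rintro x ⟨-, -, -, hx⟩; exact hx)
    suffices hS : sSup S ∈ S by
      obtain ⟨X, hX, hXa, -⟩ := hS
      exact ⟨X, hX, hXa ▸ har, fun Y hY hYr => hXa ▸ le_csSup hSb ⟨Y, hY, rfl, hYr⟩⟩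
    by_contra hS
    obtain ⟨u, hu, hut, huS⟩ := exists_seq_tendsto_sSup hSne hSb
    choose X hXC hXu hur using huS
    have hXm : Monotone fun n => (X n).1 := fun n k hnk =>
      hle _ (hXC n) _ (hXC k) (by rw [hXu, hXu]; exact hu hnk)
    have hA : μ.real (⋃ n, (X n).1) = sSup S := by
      have h1 := tendsto_measure_iUnion_atTop (μ := μ) hXm
      have h2 := (ENNReal.tendsto_toReal (measure_ne_top μ _)).comp h1
      refine tendsto_nhds_unique h2 (hut.congr fun n => ?_)
      simp [← hXu, Measure.real]
    have hAC : (⟨⋃ n, (X n).1, .iUnion fun n => (X n).2⟩ :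
        {A : Set Ω // MeasurableSet A}) ∈ C := by
      refine hmem _ fun B hB hne => ?_
      rcases le_or_gt (μ.real B.1) r with hBr | hBr
      · left
        have hBS : μ.real B.1 ∈ S := ⟨B, hB, rfl, hBr⟩
        have hBa : μ.real B.1 < sSup S :=
          lt_of_le_of_ne (le_csSup hSb hBS) fun he => hS (he ▸ hBS)
        obtain ⟨n, hn⟩ := (hut.eventually (lt_mem_nhds hBa)).exists
        refine ⟨(hlt B hB _ (hXC n) (by rwa [hXu])).trans (Set.subset_iUnion_of_subset n le_rfl), ?_⟩
        simpa only [hA] using hBa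
      · right
        refine ⟨Set.iUnion_subset fun n => hlt _ (hXC n) B hB ?_, ?_⟩
        · rw [hXu]; exact (hur n).trans_lt hBr
        · simpa only [hA] using har.trans_lt hBr
    exact hS ⟨_, hAC, hA, har⟩
  have hup : ∀ r ∈ Set.Icc (0 : ℝ) 1, ∃ X ∈ C, r ≤ μ.real X.1 ∧
      ∀ Y ∈ C, r ≤ μ.real Y.1 → μ.real X.1 ≤ μ.real Y.1 := by
    intro r hr
    let S : Set ℝ := {x | ∃ X ∈ C, μ.real X.1 = x ∧ r ≤ x}
    have hSne : S.Nonempty := ⟨1, _, huniv, by simp, hr.2⟩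
    have hSb : BddBelow S := ⟨r, by rintro x ⟨-, -, -, hx⟩; exact hx⟩
    have har : r ≤ sInf S := le_csInf hSne (by rintro x ⟨-, -, -, hx⟩; exact hx)
    suffices hS : sInf S ∈ S by
      obtain ⟨X, hX, hXa, -⟩ := hS
      exact ⟨X, hX, hXa ▸ har, fun Y hY hYr => hXa ▸ csInf_le hSb ⟨Y, hY, rfl, hYr⟩⟩
    by_contra hS
    obtain ⟨u, hu, hut, huS⟩ := exists_seq_tendsto_sInf hSne hSb
    choose X hXC hXu hur using huS
    have hXm : Antitone fun n => (X n).1 := fun n k hnk =>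
      hle _ (hXC k) _ (hXC n) (by rw [hXu, hXu]; exact hu hnk)
    have hA : μ.real (⋂ n, (X n).1) = sInf S := by
      have h1 := tendsto_measure_iInter_atTop (μ := μ)
        (fun n => (X n).2.nullMeasurableSet) hXm ⟨0, measure_ne_top μ _⟩
      have h2 := (ENNReal.tendsto_toReal (measure_ne_top μ _)).comp h1
      refine tendsto_nhds_unique h2 (hut.congr fun n => ?_)
      simp [← hXu, Measure.real]
    have hAC : (⟨⋂ n, (X n).1, .iInter fun n => (X n).2⟩ :
        {A : Set Ω // MeasurableSet A}) ∈ C := by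
      refine hmem _ fun B hB hne => ?_
      rcases le_or_gt r (μ.real B.1) with hBr | hBr
      · right
        have hBS : μ.real B.1 ∈ S := ⟨B, hB, rfl, hBr⟩
        have hBa : sInf S < μ.real B.1 :=
          lt_of_le_of_ne (csInf_le hSb hBS) fun he => hS (he ▸ hBS)
        obtain ⟨n, hn⟩ := (hut.eventually (gt_mem_nhds hBa)).exists
        refine ⟨(Set.iInter_subset_of_subset n le_rfl).trans (hlt _ (hXC n) B hB (by rwa [hXu])), ?_⟩
        simpa only [hA] using hBa
      · left
        refine ⟨Set.subset_iInter fun n => hlt B hB _ (hXC n) ?_, ?_⟩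
        · rw [hXu]; exact hBr.trans_le (hur n)
        · simpa only [hA] using hBr.trans_le har
    exact hS ⟨_, hAC, hA, har⟩
  have hex : ∀ r ∈ Set.Icc (0 : ℝ) 1, ∃ X, (MeasurableSet X ∧ μ.real X = r) ∧
      ∃ hX : MeasurableSet X, (⟨X, hX⟩ : {A : Set Ω // MeasurableSet A}) ∈ C := by
    intro r hr
    obtain ⟨X, hX, hXr, hXmax⟩ := hlow r hr
    obtain ⟨Y, hY, hYr, hYmin⟩ := hup r hr
    rcases hXr.eq_or_lt with he | hXr
    · exact ⟨X.1, ⟨X.2, he⟩, X.2, hX⟩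
    rcases hYr.eq_or_lt with he | hYr
    · exact ⟨Y.1, ⟨Y.2, he.symm⟩, Y.2, hY⟩
    exfalso
    have hXY : X.1 ⊆ Y.1 := hlt X hX Y hY (hXr.trans hYr)
    have hdiff : μ.real (Y.1 \ X.1) = μ.real Y.1 - μ.real X.1 :=
      measureReal_sdiff hXY X.2
    have hpos : μ (Y.1 \ X.1) ≠ 0 := by
      intro h0
      rw [Measure.real, h0, ENNReal.toReal_zero] at hdiff
      linarith
    obtain ⟨t, hts, htm, ht0, htlt⟩ := h _ (Y.2.diff X.2) hpos
    have ht0' : 0 < μ.real t := ENNReal.toReal_pos ht0.ne' (measure_ne_top _ _)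
    have htlt' : μ.real t < μ.real (Y.1 \ X.1) :=
      (ENNReal.toReal_lt_toReal (measure_ne_top _ _) (measure_ne_top _ _)).2 htlt
    have hdisj : Disjoint X.1 t :=
      Set.disjoint_left.2 fun x hx hxt => (hts hxt).2 hx
    have hun : μ.real (X.1 ∪ t) = μ.real X.1 + μ.real t := measureReal_union hdisj htm
    have hW : (⟨X.1 ∪ t, X.2.union htm⟩ : {A : Set Ω // MeasurableSet A}) ∈ C := by
      refine hmem _ fun B hB hne => ?_
      rcases le_or_gt (μ.real B.1) r with hBr | hBr
      · left
        have hBX := hXmax B hB hBr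
        refine ⟨(hle B hB X hX hBX).trans Set.subset_union_left, ?_⟩
        change _ < μ.real (X.1 ∪ t)
        linarith
      · right
        have hBY := hYmin B hB hBr.le
        refine ⟨(Set.union_subset hXY fun x hx => (hts hx).1).trans (hle Y hY B hB hBY), ?_⟩
        change μ.real (X.1 ∪ t) < _
        linarith
    rcases le_or_gt (μ.real (X.1 ∪ t)) r with hWr | hWr
    · have := hXmax _ hW hWr
      change μ.real (X.1 ∪ t) ≤ _ at this
      linarith
    · have := hYmin _ hW hWr.le
      change _ ≤ μ.real (X.1 ∪ t) at this
      linarith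
  choose! A hA hAC using hex
  refine ⟨A, hA, fun r hr s hs hrs => ?_⟩
  obtain ⟨h1, h2⟩ := hAC r hr
  obtain ⟨h3, h4⟩ := hAC s hs
  exact hlt _ h2 _ h4 (by simpa only [(hA r hr).2, (hA s hs).2] using hrs)

/-- An atomless probability space carries a uniformly distributed random variable. -/
theorem AtomlessMeasure.exists_uniform (h : AtomlessMeasure μ) :
    ∃ V : Ω → ℝ, Measurable V ∧ (∀ ω, V ω ∈ Set.Ico (0 : ℝ) 1) ∧
      ∀ x ∈ Set.Icc (0 : ℝ) 1, μ.real {ω | V ω < x} = x := by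
  obtain ⟨A, hA, hAm⟩ := h.exists_nested_events
  let S : Ω → Set ℝ := fun ω =>
    {r | r = 1 ∨ ∃ q : ℚ, (q : ℝ) ∈ Set.Ico (0 : ℝ) 1 ∧ (q : ℝ) = r ∧ ω ∈ A q}
  have hSne : ∀ ω, (S ω).Nonempty := fun ω => ⟨1, Or.inl rfl⟩
  have hS0 : ∀ ω, ∀ r ∈ S ω, 0 ≤ r := by
    rintro ω r (rfl | ⟨q, hq, rfl, -⟩)
    · exact zero_le_one
    · exact hq.1
  let V₀ : Ω → ℝ := fun ω => sInf (S ω)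
  have hV₀ : ∀ ω, 0 ≤ V₀ ω := fun ω => le_csInf (hSne ω) (hS0 ω)
  have hlt : ∀ x ≤ (1 : ℝ), {ω | V₀ ω < x} =
      ⋃ q : ℚ, ⋃ _ : (q : ℝ) ∈ Set.Ico (0 : ℝ) 1 ∧ (q : ℝ) < x, A q := by
    intro x hx
    ext ω
    simp only [Set.mem_ofPred_eq, V₀, csInf_lt_iff ⟨0, hS0 ω⟩ (hSne ω), Set.mem_iUnion]
    constructor
    · rintro ⟨b, (rfl | ⟨q, hq, rfl, hω⟩), hb⟩
      · exact absurd hb hx.not_gt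
      · exact ⟨q, ⟨hq, hb⟩, hω⟩
    · rintro ⟨q, ⟨hq, hb⟩, hω⟩
      exact ⟨q, Or.inr ⟨q, hq, rfl, hω⟩, hb⟩
  have hmeas : ∀ x ≤ (1 : ℝ), MeasurableSet {ω | V₀ ω < x} := by
    intro x hx
    rw [hlt x hx]
    exact .iUnion fun q => .iUnion fun hq => (hA q ⟨hq.1.1, hq.1.2.le⟩).1
  have hmu : ∀ x ∈ Set.Icc (0 : ℝ) 1, μ.real {ω | V₀ ω < x} = x := by
    intro x hx
    apply le_antisymm
    · conv_rhs => rw [← (hA x hx).2]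
      refine measureReal_mono ?_
      rw [hlt x hx.2]
      exact Set.iUnion_subset fun q => Set.iUnion_subset fun hq =>
        hAm q ⟨hq.1.1, hq.1.2.le⟩ x hx hq.2
    · refine le_of_forall_lt fun y hy => ?_
      obtain ⟨q, hyq, hqx⟩ := exists_rat_btwn hy
      rcases lt_or_ge y 0 with hy0 | hy0
      · exact hy0.trans_le measureReal_nonneg
      have hq0 : (0 : ℝ) ≤ q := hy0.trans hyq.le
      have hq1 : (q : ℝ) < 1 := hqx.trans_le hx.2
      refine hyq.trans_le ?_
      conv_lhs => rw [← (hA q ⟨hq0, hq1.le⟩).2]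
      refine measureReal_mono ?_
      rw [hlt x hx.2]
      exact Set.subset_iUnion₂_of_subset q ⟨⟨hq0, hq1⟩, hqx⟩ le_rfl
  refine ⟨fun ω => if V₀ ω < 1 then V₀ ω else 0, ?_, ?_, ?_⟩
  · refine measurable_of_Iio fun x => ?_
    have : (fun ω => if V₀ ω < 1 then V₀ ω else 0) ⁻¹' Set.Iio x =
        {ω | V₀ ω < min x 1} ∪ ({ω | V₀ ω < 1}ᶜ ∩ {_ω | 0 < x}) := by
      ext ω
      simp only [Set.mem_preimage, Set.mem_Iio, Set.mem_union, Set.mem_ofPred_eq, Set.mem_inter_iff,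
        Set.mem_compl_iff, lt_min_iff]
      split_ifs with h1 <;> simp [h1]
    rw [this]
    exact (hmeas _ (min_le_right _ _)).union ((hmeas 1 le_rfl).compl.inter (.const _))
  · intro ω
    dsimp only
    split_ifs with h1
    · exact ⟨hV₀ ω, h1⟩
    · simp
  · intro x hx
    have hae : (fun ω => if V₀ ω < 1 then V₀ ω else 0) =ᵐ[μ] V₀ := by
      have h1 : ∀ᵐ ω ∂μ, V₀ ω < 1 := by
        refine (mem_ae_iff_prob_eq_one (hmeas 1 le_rfl)).2 ?_
        rw [← ENNReal.toReal_eq_one_iff]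
        exact hmu 1 ⟨zero_le_one, le_rfl⟩
      filter_upwards [h1] with ω hω
      simp [hω]
    conv_rhs => rw [← hmu x hx]
    refine measureReal_congr ?_
    filter_upwards [hae] with ω hω
    exact congrArg (· < x) hω

theorem tail_antitone (f : Ω → ℝ) : Antitone fun t => μ.real {ω | t < f ω} := fun _ _ hst =>
  measureReal_mono fun _ hω => lt_of_le_of_lt hst hω

theorem tail_mem_Icc (f : Ω → ℝ) (t : ℝ) : μ.real {ω | t < f ω} ∈ Set.Icc (0 : ℝ) 1 :=
  ⟨measureReal_nonneg, measureReal_le_one⟩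

theorem IsDistortion.tail_antitone {T : ℝ → ℝ} (hT : IsDistortion T) (f : Ω → ℝ) :
    Antitone fun t => T (μ.real {ω | t < f ω}) := fun _ _ hst =>
  hT.1 (tail_mem_Icc f _) (tail_mem_Icc f _) (_root_.tail_antitone f hst)

theorem IsDistortion.tail_mem_Icc {T : ℝ → ℝ} (hT : IsDistortion T) (f : Ω → ℝ) (t : ℝ) :
    T (μ.real {ω | t < f ω}) ∈ Set.Icc (0 : ℝ) 1 :=
  hT.2.1 _ (_root_.tail_mem_Icc f t)

/-- For a random variable bounded by `M`, the Choquet integral is an integral over `[-M, M]`. -/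
theorem IsDistortion.choquet_eq {T : ℝ → ℝ} (hT : IsDistortion T) {f : Ω → ℝ} {M : ℝ}
    (hf : ∀ᵐ ω ∂μ, |f ω| ≤ M) :
    choquet μ T f = (∫ t in (-M)..M, T (μ.real {ω | t < f ω})) - M := by
  have hM : 0 ≤ M := by
    obtain ⟨ω, hω⟩ := hf.exists
    exact (abs_nonneg _).trans hω
  have hhigh : ∀ t, M ≤ t → T (μ.real {ω | t < f ω}) = 0 := by
    intro t ht
    have : μ {ω | t < f ω} = 0 := by
      refine measure_mono_null ?_ hf
      intro ω hω hle
      exact absurd (hω.trans_le ((le_abs_self _).trans hle)) ht.not_gt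
    rw [Measure.real, this, ENNReal.toReal_zero, hT.2.2.1]
  have hlow : ∀ t, t < -M → T (μ.real {ω | t < f ω}) = 1 := by
    intro t ht
    have : μ {ω | t < f ω} = μ Set.univ := by
      refine measure_congr ?_
      filter_upwards [hf] with ω hω
      refine propext ⟨fun _ => trivial, fun _ => ?_⟩
      exact ht.trans_le (abs_le.1 hω).1
    rw [Measure.real, this, measure_univ, ENNReal.toReal_one, hT.2.2.2]
  have hint : ∀ a b, IntervalIntegrable (fun t => T (μ.real {ω | t < f ω})) volume a b :=
    fun a b => (hT.tail_antitone f).intervalIntegrable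
  have h1 : ∫ t in Set.Ioi (0 : ℝ), T (μ.real {ω | t < f ω}) =
      ∫ t in (0 : ℝ)..M, T (μ.real {ω | t < f ω}) := by
    rw [intervalIntegral.integral_of_le hM]
    refine setIntegral_eq_of_subset_of_forall_sdiff_eq_zero measurableSet_Ioi
      (fun x hx => hx.1) fun t ht => hhigh t ?_
    by_contra hlt
    exact ht.2 ⟨ht.1, (not_le.1 hlt).le⟩
  have h2 : ∫ t in Set.Iio (0 : ℝ), (T (μ.real {ω | t < f ω}) - 1) =
      (∫ t in (-M)..0, T (μ.real {ω | t < f ω})) - M := by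
    have : (∫ t in (-M)..0, (T (μ.real {ω | t < f ω}) - 1)) =
        (∫ t in (-M)..0, T (μ.real {ω | t < f ω})) - M := by
      rw [intervalIntegral.integral_sub (hint _ _) (by simp)]
      simp
    rw [← this, intervalIntegral.integral_of_le (by linarith), integral_Ioc_eq_integral_Ioo,
      ← integral_Ico_eq_integral_Ioo]
    refine setIntegral_eq_of_subset_of_forall_sdiff_eq_zero measurableSet_Iio
      (fun x hx => hx.2) fun t ht => ?_
    rw [hlow t, sub_self]
    by_contra hlt
    exact ht.2 ⟨not_lt.1 hlt, ht.1⟩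
  rw [← intervalIntegral.integral_add_adjacent_intervals (hint (-M) 0) (hint 0 M)]
  change (∫ t in Set.Ioi (0 : ℝ), T (μ.real {ω | t < f ω})) +
    (∫ t in Set.Iio (0 : ℝ), (T (μ.real {ω | t < f ω}) - 1)) = _
  rw [h1, h2]
  ring

theorem choquet_congr_tail {T : ℝ → ℝ} {f g : Ω → ℝ}
    (h : ∀ t, μ.real {ω | t < f ω} = μ.real {ω | t < g ω}) : choquet μ T f = choquet μ T g := by
  change (∫ t in Set.Ioi (0 : ℝ), T (μ.real {ω | t < f ω})) +
    (∫ t in Set.Iio (0 : ℝ), (T (μ.real {ω | t < f ω}) - 1)) =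
    (∫ t in Set.Ioi (0 : ℝ), T (μ.real {ω | t < g ω})) +
    (∫ t in Set.Iio (0 : ℝ), (T (μ.real {ω | t < g ω}) - 1))
  simp only [h]

theorem IsDistortion.choquet_mono {T : ℝ → ℝ} (hT : IsDistortion T) {f g : Ω → ℝ} {M : ℝ}
    (hf : ∀ᵐ ω ∂μ, |f ω| ≤ M) (hg : ∀ᵐ ω ∂μ, |g ω| ≤ M) (hfg : f ≤ᵐ[μ] g) :
    choquet μ T f ≤ choquet μ T g := by
  have hM : 0 ≤ M := by
    obtain ⟨ω, hω⟩ := hf.exists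
    exact (abs_nonneg _).trans hω
  rw [hT.choquet_eq hf, hT.choquet_eq hg]
  gcongr
  refine intervalIntegral.integral_mono_on (by linarith) (hT.tail_antitone f).intervalIntegrable
    (hT.tail_antitone g).intervalIntegrable fun t _ => ?_
  refine hT.1 (_root_.tail_mem_Icc f _) (_root_.tail_mem_Icc g _) ?_
  refine ENNReal.toReal_mono (measure_ne_top _ _) (measure_mono_ae ?_)
  filter_upwards [hfg] with ω hω h
  exact lt_of_lt_of_le h hω

/-- Dominated convergence for Choquet integrals. -/
theorem tendsto_choquet {T : ℕ → ℝ → ℝ} {T' : ℝ → ℝ} (hT : ∀ n, IsDistortion (T n))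
    (hT' : IsDistortion T') {F : ℕ → Ω → ℝ} {f : Ω → ℝ} {M : ℝ}
    (hF : ∀ n, ∀ᵐ ω ∂μ, |F n ω| ≤ M) (hf : ∀ᵐ ω ∂μ, |f ω| ≤ M)
    (h : ∀ᵐ t, Tendsto (fun n => T n (μ.real {ω | t < F n ω})) atTop
      (nhds (T' (μ.real {ω | t < f ω})))) :
    Tendsto (fun n => choquet μ (T n) (F n)) atTop (nhds (choquet μ T' f)) := by
  rw [hT'.choquet_eq hf]
  simp only [(hT _).choquet_eq (hF _)]
  refine Tendsto.sub_const ?_ M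
  refine intervalIntegral.tendsto_integral_filter_of_dominated_convergence (fun _ => 1)
    (.of_forall fun n => ((hT n).tail_antitone _).measurable.aestronglyMeasurable)
    (.of_forall fun n => .of_forall fun t _ => ?_) (by simp) (h.mono fun t ht _ => ht)
  obtain ⟨h0, h1⟩ := (hT n).tail_mem_Icc (μ := μ) (F n) t
  rwa [Real.norm_of_nonneg h0]

theorem IsConvexDistortion.abs_sub_le {T : ℝ → ℝ} (hT : IsConvexDistortion T) {a b δ : ℝ}
    (ha : a ∈ Set.Icc 0 δ) (hb : b ∈ Set.Icc 0 δ) (hδ : δ < 1) :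
    |T a - T b| ≤ |a - b| / (1 - δ) := by
  wlog hab : a ≤ b generalizing a b
  · rw [abs_sub_comm, abs_sub_comm a]
    exact this hb ha (le_of_not_ge hab)
  have haI : a ∈ Set.Icc (0 : ℝ) 1 := ⟨ha.1, ha.2.trans hδ.le⟩
  have hbI : b ∈ Set.Icc (0 : ℝ) 1 := ⟨hb.1, hb.2.trans hδ.le⟩
  have hmono := hT.1.1 haI hbI hab
  have h1a : 0 < 1 - a := by linarith [ha.2]
  have hconv : T b ≤ (1 - b) / (1 - a) * T a + (b - a) / (1 - a) * T 1 := by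
    obtain ⟨-, hc⟩ := hT.2
    have := hc haI (y := 1) (by simp) (a := (1 - b) / (1 - a)) (b := (b - a) / (1 - a))
      (div_nonneg (by linarith [hb.2]) h1a.le) (div_nonneg (by linarith) h1a.le)
      (by field_simp; ring)
    have hb' : (1 - b) / (1 - a) * a + (b - a) / (1 - a) * 1 = b := by field_simp; ring
    simp only [smul_eq_mul] at this
    rwa [hb'] at this
  rw [hT.1.2.2.2] at hconv
  have hTa := (hT.1.2.1 a haI).1
  rw [abs_sub_comm, abs_sub_comm a, abs_of_nonneg (by linarith), abs_of_nonneg (by linarith)]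
  calc T b - T a ≤ (b - a) / (1 - a) * (1 - T a) := by
        have : (1 - b) / (1 - a) = 1 - (b - a) / (1 - a) := by field_simp; ring
        rw [this] at hconv
        linarith
    _ ≤ (b - a) / (1 - a) := mul_le_of_le_one_right (div_nonneg (by linarith) h1a.le) (by linarith)
    _ ≤ (b - a) / (1 - δ) := by
        have : 0 < 1 - δ := by linarith
        gcongr
        exact ha.2

theorem IsConvexDistortion.tendsto {T : ℝ → ℝ} (hT : IsConvexDistortion T) {u : ℕ → ℝ} {a : ℝ}
    (hu : ∀ n, u n ∈ Set.Icc (0 : ℝ) 1) (ha : a ∈ Set.Ico (0 : ℝ) 1)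
    (h : Tendsto u atTop (nhds a)) : Tendsto (fun n => T (u n)) atTop (nhds (T a)) := by
  obtain ⟨δ, haδ, hδ⟩ := exists_between ha.2
  rw [tendsto_iff_dist_tendsto_zero] at h ⊢
  refine squeeze_zero' (.of_forall fun _ => dist_nonneg) ?_
    (by simpa using h.div_const (1 - δ))
  filter_upwards [(tendsto_iff_dist_tendsto_zero.2 h).eventually (gt_mem_nhds haδ)] with n hn
  exact hT.abs_sub_le ⟨(hu n).1, hn.le⟩ ⟨ha.1, haδ.le⟩ hδ

/-- Bounded a.s. convergence implies convergence of Choquet integrals for convex distortions,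
provided that tails of full probability are preserved. -/
theorem IsConvexDistortion.tendsto_choquet {T : ℝ → ℝ} (hT : IsConvexDistortion T)
    {F : ℕ → Ω → ℝ} {f : Ω → ℝ} {M : ℝ} (hFm : ∀ n, Measurable (F n)) (hfm : Measurable f)
    (hF : ∀ n, ∀ᵐ ω ∂μ, |F n ω| ≤ M) (hf : ∀ᵐ ω ∂μ, |f ω| ≤ M)
    (hlim : ∀ᵐ ω ∂μ, Tendsto (fun n => F n ω) atTop (nhds (f ω)))
    (htail : ∀ᵐ t, μ.real {ω | t < f ω} = 1 → ∀ n, μ.real {ω | t < F n ω} = 1) :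
    Tendsto (fun n => choquet μ T (F n)) atTop (nhds (choquet μ T f)) := by
  refine _root_.tendsto_choquet (fun _ => hT.1) hT.1 hF hf ?_
  have hatom : ∀ᵐ t : ℝ, μ {ω | f ω = t} = 0 := by
    have hc := Measure.countable_meas_level_set_pos (μ := μ) hfm
    filter_upwards [hc.ae_notMem volume] with t ht
    simpa using ht
  filter_upwards [htail, hatom] with t ht hat
  rcases (_root_.tail_mem_Icc (μ := μ) f t).2.eq_or_lt with h1 | h1
  · simp only [ht h1, h1, tendsto_const_nhds]
  refine hT.tendsto (fun n => _root_.tail_mem_Icc _ _) ⟨measureReal_nonneg, h1⟩ ?_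
  refine (ENNReal.tendsto_toReal (measure_ne_top _ _)).comp ?_
  refine tendsto_measure_of_ae_tendsto_indicator_of_isFiniteMeasure atTop
    (measurableSet_lt measurable_const hfm) (fun n => measurableSet_lt measurable_const (hFm n)) ?_
  have hne : ∀ᵐ ω ∂μ, f ω ≠ t := by simpa [ae_iff] using hat
  filter_upwards [hlim, hne] with ω hω hneω
  rcases hneω.lt_or_gt with hlt | hlt
  · filter_upwards [hω.eventually (gt_mem_nhds hlt)] with n hn
    exact ⟨fun h => absurd h (not_lt.2 hn.le), fun h => absurd h (not_lt.2 hlt.le)⟩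
  · filter_upwards [hω.eventually (lt_mem_nhds hlt)] with n hn
    exact ⟨fun _ => hlt, fun _ => hn⟩

/-- `V` is uniformly distributed on `[0, 1)`. -/
structure IsUniform (μ : Measure Ω) (V : Ω → ℝ) : Prop where
  measurable : Measurable V
  mem_Ico : ∀ ω, V ω ∈ Set.Ico (0 : ℝ) 1
  law : ∀ x ∈ Set.Icc (0 : ℝ) 1, μ.real {ω | V ω < x} = x

namespace IsUniform

variable {V : Ω → ℝ}

theorem measurable_floor (hV : IsUniform μ V) (N : ℕ) : Measurable fun ω => ⌊N * V ω⌋₊ :=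
  Nat.measurable_floor.comp (hV.measurable.const_mul _)

theorem measurable_step (hV : IsUniform μ V) (N : ℕ) (y : ℕ → ℝ) :
    Measurable fun ω => y ⌊N * V ω⌋₊ :=
  (Measurable.of_discrete (f := y)).comp (hV.measurable_floor N)

theorem floor_lt (hV : IsUniform μ V) {N : ℕ} (hN : 0 < N) (ω : Ω) : ⌊N * V ω⌋₊ < N := by
  have hN' : (0 : ℝ) < N := by exact_mod_cast hN
  rw [Nat.floor_lt (mul_nonneg hN'.le (hV.mem_Ico ω).1)]
  exact mul_lt_of_lt_one_right hN' (hV.mem_Ico ω).2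

theorem le_floor_iff (hV : IsUniform μ V) {N : ℕ} (hN : 0 < N) (k : ℕ) (ω : Ω) :
    k ≤ ⌊N * V ω⌋₊ ↔ ¬ V ω < k / N := by
  have hN' : (0 : ℝ) < N := by exact_mod_cast hN
  rw [Nat.le_floor_iff (mul_nonneg hN'.le (hV.mem_Ico ω).1), not_lt, div_le_iff₀' hN']

theorem measureReal_le_floor (hV : IsUniform μ V) {N : ℕ} (hN : 0 < N) {k : ℕ} (hk : k ≤ N) :
    μ.real {ω | k ≤ ⌊N * V ω⌋₊} = ((N : ℝ) - k) / N := by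
  have hN' : (0 : ℝ) < N := by exact_mod_cast hN
  have hk' : (k : ℝ) / N ∈ Set.Icc (0 : ℝ) 1 :=
    ⟨by positivity, div_le_one_of_le₀ (by exact_mod_cast hk) hN'.le⟩
  have : {ω | k ≤ ⌊N * V ω⌋₊} = {ω | V ω < k / N}ᶜ := by
    ext ω
    exact hV.le_floor_iff hN k ω
  rw [this, probReal_compl_eq_one_sub (measurableSet_lt hV.measurable measurable_const),
    hV.law _ hk']
  field_simp

theorem measureReal_floor_eq (hV : IsUniform μ V) {N : ℕ} (hN : 0 < N) {k : ℕ} (hk : k < N) :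
    μ.real {ω | ⌊N * V ω⌋₊ = k} = 1 / N := by
  have : {ω | ⌊N * V ω⌋₊ = k} = {ω | k ≤ ⌊N * V ω⌋₊} \ {ω | k + 1 ≤ ⌊N * V ω⌋₊} := by
    ext ω
    simp only [Set.mem_ofPred_eq, Set.mem_sdiff]
    omega
  have hsub : {ω | k + 1 ≤ ⌊N * V ω⌋₊} ⊆ {ω | k ≤ ⌊N * V ω⌋₊} := by
    intro ω h
    exact (Nat.le_succ k).trans h
  rw [this, measureReal_sdiff hsub
    (measurableSet_le measurable_const (hV.measurable_floor N)), hV.measureReal_le_floor hN hk.le,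
    hV.measureReal_le_floor hN hk]
  push_cast
  ring

theorem measureReal_singleton (hV : IsUniform μ V) (x : ℝ) : μ.real {ω | V ω = x} = 0 := by
  by_cases hx : x ∈ Set.Ico (0 : ℝ) 1
  · refine le_antisymm (le_of_forall_gt_imp_ge_of_dense fun ε hε => ?_) measureReal_nonneg
    set y := min (x + ε) 1
    have hxy : x < y := lt_min (by linarith) hx.2
    have h : {ω | V ω = x} ⊆ {ω | V ω < y} \ {ω | V ω < x} := by
      rintro ω rfl
      exact ⟨hxy, fun h : V ω < V ω => lt_irrefl _ h⟩
    have hsub : {ω | V ω < x} ⊆ {ω | V ω < y} := by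
      intro ω h
      exact lt_trans h hxy
    calc μ.real {ω | V ω = x} ≤ _ := measureReal_mono h
      _ = y - x := by
        rw [measureReal_sdiff hsub
          (measurableSet_lt hV.measurable measurable_const), hV.law _ ⟨hx.1, hx.2.le⟩,
          hV.law _ ⟨hx.1.trans hxy.le, min_le_right _ _⟩]
      _ ≤ ε := by linarith [min_le_left (x + ε) 1]
  · have : {ω | V ω = x} = ∅ := by
      ext ω
      simp only [Set.mem_ofPred_eq, Set.mem_empty_iff_false, iff_false]
      rintro rfl
      exact hx (hV.mem_Ico ω)
    simp [this]

theorem measureReal_le (hV : IsUniform μ V) {x : ℝ} (hx : x ∈ Set.Icc (0 : ℝ) 1) :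
    μ.real {ω | V ω ≤ x} = x := by
  refine le_antisymm ?_ ?_
  · have : {ω | V ω ≤ x} = {ω | V ω < x} ∪ {ω | V ω = x} := by
      ext ω
      change V ω ≤ x ↔ V ω < x ∨ V ω = x
      exact le_iff_lt_or_eq
    rw [this]
    refine (measureReal_union_le _ _).trans ?_
    rw [hV.law x hx, hV.measureReal_singleton, add_zero]
  · conv_lhs => rw [← hV.law x hx]
    exact measureReal_mono fun ω (h : V ω < x) => h.le

theorem ae_notMem (hV : IsUniform μ V) {s : Set ℝ} (hs : s.Countable) : ∀ᵐ ω ∂μ, V ω ∉ s := by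
  have h : ∀ᵐ ω ∂μ, ∀ x ∈ s, V ω ≠ x := by
    rw [ae_ball_iff hs]
    intro x _
    rw [ae_iff]
    simpa [Measure.real, ENNReal.toReal_eq_zero_iff] using hV.measureReal_singleton x
  filter_upwards [h] with ω hω hmem
  exact hω _ hmem rfl

theorem exists_bound (hV : IsUniform μ V) {N : ℕ} (hN : 0 < N) (y : ℕ → ℝ) :
    ∃ M : ℝ, (∀ k < N, |y k| ≤ M) ∧ ∀ ω, |y ⌊N * V ω⌋₊| ≤ M := by
  have h : ∀ k < N, |y k| ≤ ∑ k ∈ Finset.range N, |y k| := fun k hk =>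
    Finset.single_le_sum (f := fun k => |y k|) (fun _ _ => abs_nonneg _) (Finset.mem_range.2 hk)
  exact ⟨_, h, fun ω => h _ (hV.floor_lt hN ω)⟩

/-- The Choquet integral of a monotone step function of a uniform random variable. -/
theorem choquet_step (hV : IsUniform μ V) {N : ℕ} (hN : 0 < N) {T : ℝ → ℝ} (hT : IsDistortion T)
    {y : ℕ → ℝ} (hy : Monotone y) :
    choquet μ T (fun ω => y ⌊N * V ω⌋₊) =
      ∑ k ∈ Finset.range N, y k * (T (((N : ℝ) - k) / N) - T (((N : ℝ) - (k + 1)) / N)) := by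
  have hN' : (0 : ℝ) < N := by exact_mod_cast hN
  obtain ⟨M, hM, hMω⟩ := hV.exists_bound hN y
  have hM0 : 0 ≤ M := (abs_nonneg _).trans (hM 0 hN)
  set g : ℕ → ℝ := fun k => T (((N : ℝ) - k) / N) with hg
  have hgN : g N = 0 := by simp [hg, hT.2.2.1]
  have hg0 : g 0 = 1 := by simp [hg, hN'.ne', hT.2.2.2]
  have htel : ∀ j ≤ N, ∑ k ∈ Finset.Ico j N, (g k - g (k + 1)) = g j := by
    intro j hj
    have := Finset.sum_Ico_sub (fun k => -g k) hj
    simpa [hgN, sub_eq_add_neg, add_comm] using this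
  have htail : ∀ t, T (μ.real {ω | t < y ⌊N * V ω⌋₊}) =
      ∑ k ∈ Finset.range N, (Set.Iio (y k)).indicator (fun _ => g k - g (k + 1)) t := by
    intro t
    obtain ⟨j, hj, hjlt, hjge⟩ : ∃ j ≤ N, (∀ k < j, y k ≤ t) ∧ ∀ k < N, j ≤ k → t < y k := by
      by_cases h : ∃ k, t < y k
      · refine ⟨min (Nat.find h) N, min_le_right _ _, fun k hk => ?_, fun k hk hjk => ?_⟩
        · exact not_lt.1 (Nat.find_min h (hk.trans_le (min_le_left _ _)))
        · have : Nat.find h ≤ k := by omega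
          exact (Nat.find_spec h).trans_le (hy this)
      · push Not at h
        exact ⟨N, le_rfl, fun k _ => h k, fun k hk hk' => absurd hk hk'.not_gt⟩
    have hset : {ω | t < y ⌊N * V ω⌋₊} = {ω | j ≤ ⌊N * V ω⌋₊} := by
      ext ω
      refine ⟨fun h => ?_, fun h => hjge _ (hV.floor_lt hN ω) h⟩
      by_contra hlt
      exact absurd h (hjlt _ (not_le.1 hlt)).not_gt
    rw [hset, hV.measureReal_le_floor hN hj]
    change g j = _
    rw [← htel j hj, Finset.range_eq_Ico, ← Finset.sum_Ico_consecutive _ (Nat.zero_le j) hj]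
    rw [Finset.sum_eq_zero (s := Finset.Ico 0 j), zero_add]
    · refine Finset.sum_congr rfl fun k hk => ?_
      rw [Finset.mem_Ico] at hk
      rw [Set.indicator_of_mem (Set.mem_Iio.2 (hjge k hk.2 hk.1))]
    · intro k hk
      rw [Finset.mem_Ico] at hk
      exact Set.indicator_of_notMem (fun h => absurd (Set.mem_Iio.1 h) (hjlt k hk.2).not_gt) _
  have hind : ∀ k < N, ∀ d : ℝ, ∫ t in (-M)..M, (Set.Iio (y k)).indicator (fun _ => d) t =
      (y k + M) * d := by
    intro k hk d
    have hyk := abs_le.1 (hM k hk)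
    rw [intervalIntegral.integral_of_le (by linarith), setIntegral_indicator measurableSet_Iio]
    have : Set.Ioc (-M) M ∩ Set.Iio (y k) = Set.Ioo (-M) (y k) := by
      ext t
      simp only [Set.mem_inter_iff, Set.mem_Ioc, Set.mem_Iio, Set.mem_Ioo]
      exact ⟨fun h => ⟨h.1.1, h.2⟩, fun h => ⟨⟨h.1, (h.2.trans_le hyk.2).le⟩, h.2⟩⟩
    rw [this, setIntegral_const, Real.volume_real_Ioo_of_le hyk.1, smul_eq_mul]
    ring
  rw [hT.choquet_eq (M := M) (.of_forall hMω)]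
  simp only [htail]
  rw [intervalIntegral.integral_finsetSum]
  · rw [Finset.sum_congr rfl fun k hk => hind k (Finset.mem_range.1 hk) _]
    simp only [add_mul, Finset.sum_add_distrib, ← Finset.mul_sum]
    have h1 := htel 0 (Nat.zero_le _)
    rw [← Finset.range_eq_Ico, hg0] at h1
    rw [h1]
    simp [hg]
  · intro k _
    rw [intervalIntegrable_iff]
    exact (integrableOn_const (by simp)).indicator measurableSet_Iio

end IsUniform

/-- Nonincreasing weights on `N` equal blocks come from a convex distortion function. -/
theorem exists_convexDistortion_of_antitone {N : ℕ} (hN : 0 < N) {p : ℕ → ℝ} (hp : Antitone p)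
    (hpN : p N = 0) (hsum : ∑ k ∈ Finset.range N, p k = 1) :
    ∃ T, IsConvexDistortion T ∧
      ∀ k < N, T (((N : ℝ) - k) / N) - T (((N : ℝ) - (k + 1)) / N) = p k := by
  have hN' : (0 : ℝ) < N := by exact_mod_cast hN
  let T : ℝ → ℝ := fun x =>
    ∑ j ∈ Finset.range N, (p j - p (j + 1)) * max 0 (N * x - ((N : ℝ) - (j + 1)))
  have hc : ∀ j, 0 ≤ p j - p (j + 1) := fun j => sub_nonneg.2 (hp (Nat.le_succ j))
  have hconv : ConvexOn ℝ Set.univ T := by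
    have : ∀ s : Finset ℕ, ConvexOn ℝ Set.univ fun x =>
        ∑ j ∈ s, (p j - p (j + 1)) * max 0 (N * x - ((N : ℝ) - (j + 1))) := by
      intro s
      induction s using Finset.induction_on with
      | empty => simpa using convexOn_const 0 convex_univ
      | insert j s hj ih =>
        simp only [Finset.sum_insert hj]
        refine ConvexOn.add ?_ ih
        refine ConvexOn.smul (hc j) ((convexOn_const 0 convex_univ).sup ?_)
        refine ⟨convex_univ, fun x _ y _ a b _ _ hab => le_of_eq ?_⟩
        simp only [smul_eq_mul]
        linear_combination -((N : ℝ) - (j + 1)) * hab.symm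
    exact this _
  have hmono : Monotone T := fun x y hxy => by
    refine Finset.sum_le_sum fun j _ => mul_le_mul_of_nonneg_left ?_ (hc j)
    gcongr
  have h0 : T 0 = 0 := by
    refine Finset.sum_eq_zero fun j hj => ?_
    have : (j : ℝ) + 1 ≤ N := by exact_mod_cast Finset.mem_range.1 hj
    rw [max_eq_left (by linarith), mul_zero]
  have htel : ∀ j ≤ N, ∑ k ∈ Finset.Ico j N, (p k - p (k + 1)) = p j := by
    intro j hj
    have := Finset.sum_Ico_sub (fun k => -p k) hj
    simpa [hpN, sub_eq_add_neg, add_comm] using this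
  have hstep : ∀ k < N, T (((N : ℝ) - k) / N) - T (((N : ℝ) - (k + 1)) / N) = p k := by
    intro k hk
    simp only [T]
    rw [← Finset.sum_sub_distrib, ← htel k hk.le, Finset.range_eq_Ico,
      ← Finset.sum_Ico_consecutive _ (Nat.zero_le k) hk.le, Finset.sum_eq_zero (s := Finset.Ico 0 k),
      zero_add]
    · refine Finset.sum_congr rfl fun j hj => ?_
      have hkj : (k : ℝ) ≤ j := by exact_mod_cast (Finset.mem_Ico.1 hj).1
      rw [mul_div_cancel₀ _ hN'.ne', mul_div_cancel₀ _ hN'.ne', max_eq_right (by linarith),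
        max_eq_right (by linarith)]
      ring
    · intro j hj
      have hkj : (j : ℝ) + 1 ≤ k := by exact_mod_cast (Finset.mem_Ico.1 hj).2
      rw [mul_div_cancel₀ _ hN'.ne', mul_div_cancel₀ _ hN'.ne', max_eq_left (by linarith),
        max_eq_left (by linarith)]
      ring
  have h1 : T 1 = 1 := by
    have h : ∑ k ∈ Finset.range N, (T (((N : ℝ) - k) / N) - T (((N : ℝ) - (k + 1 : ℕ)) / N)) = 1 := by
      rw [← hsum]
      refine Finset.sum_congr rfl fun k hk => ?_
      rw [← hstep k (Finset.mem_range.1 hk)]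
      push_cast
      rfl
    rw [Finset.sum_range_sub' (fun k : ℕ => T (((N : ℝ) - k) / N))] at h
    simpa [hN'.ne', h0] using h
  refine ⟨T, ⟨⟨hmono.monotoneOn _, fun x hx => ⟨?_, ?_⟩, h0, h1⟩,
    hconv.subset (Set.subset_univ _) (convex_Icc 0 1)⟩, hstep⟩
  · rw [← h0]; exact hmono hx.1
  · rw [← h1]; exact hmono hx.2

/-- A law-invariant positively homogeneous monetary utility. -/
structure IsCoherentUtility (U : Xinf μ → ℝ) : Prop where
  mono : UMonotone U
  concave : ConcaveOn ℝ Set.univ U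
  translation : TranslationInvariant U
  law : LawInvariant U
  posHom : PositivelyHomogeneous U

namespace IsCoherentUtility

variable {U : Xinf μ → ℝ}

theorem map_zero (hU : IsCoherentUtility U) : U 0 = 0 := by
  simpa using hU.posHom 0 0 le_rfl

theorem map_const (hU : IsCoherentUtility U) (c : ℝ) : U (Lp.const ⊤ μ c) = c := by
  simpa [hU.map_zero] using hU.translation 0 c

theorem add_le (hU : IsCoherentUtility U) (X Y : Xinf μ) : U X + U Y ≤ U (X + Y) := by
  obtain ⟨-, hc⟩ := hU.concave
  have h := hc (Set.mem_univ X) (Set.mem_univ Y) (a := 1 / 2) (b := 1 / 2)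
    (by norm_num) (by norm_num) (by norm_num)
  rw [← smul_add (1 / 2 : ℝ) X Y, hU.posHom _ _ (by norm_num)] at h
  simp only [smul_eq_mul] at h
  linarith

theorem exists_supporting (hU : IsCoherentUtility U) (Z : Xinf μ) :
    ∃ ℓ : Xinf μ →ₗ[ℝ] ℝ, (∀ Y, U Y ≤ ℓ Y) ∧ ℓ Z = U Z := by
  have H : ∀ c : ℝ, c • Z = 0 → RingHom.id ℝ c • (-U Z) = 0 := by
    intro c hc
    rcases smul_eq_zero.1 hc with h | h
    · simp [h]
    · simp [h, hU.map_zero]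
  obtain ⟨g, hg, hgU⟩ := exists_extension_of_le_sublinear
    (LinearPMap.mkSpanSingleton' Z (-U Z) H) (fun Y => -U Y)
    (fun c hc x => by rw [hU.posHom x c hc.le]; ring)
    (fun x y => by linarith [hU.add_le x y])
    (by
      rintro ⟨x, hx⟩
      obtain ⟨c, rfl⟩ := Submodule.mem_span_singleton.1 hx
      rw [LinearPMap.mkSpanSingleton'_apply]
      simp only [RingHom.id_apply, smul_eq_mul]
      rcases le_total 0 c with hc | hc
      · rw [hU.posHom Z c hc]
        linarith
      · have h1 := hU.posHom Z (-c) (by linarith)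
        have h2 := hU.add_le (c • Z) (-c • Z)
        rw [neg_smul, add_neg_cancel, hU.map_zero, ← neg_smul, h1] at h2
        linarith)
  refine ⟨-g, fun Y => ?_, ?_⟩
  · have := hgU Y
    simp only [LinearMap.neg_apply]
    linarith
  · have hmem : Z ∈ (LinearPMap.mkSpanSingleton' Z (-U Z) H).domain :=
      Submodule.mem_span_singleton_self Z
    have := hg ⟨Z, hmem⟩
    rw [LinearPMap.mkSpanSingleton'_apply_self] at this
    simp [this]

theorem law_comp (hU : IsCoherentUtility U) {ι : Type*} {W W' : Ω → ι} [MeasurableSpace ι]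
    (h : IdentDistrib W W' μ μ) {f : ι → ℝ} (hf : Measurable f) {Y Y' : Xinf μ}
    (hY : Y =ᵐ[μ] f ∘ W) (hY' : Y' =ᵐ[μ] f ∘ W') : U Y = U Y' := by
  refine hU.law Y Y' ?_
  refine (IdentDistrib.of_ae_eq (Lp.aestronglyMeasurable Y).aemeasurable hY).trans ?_
  refine (h.comp hf).trans ?_
  exact (IdentDistrib.of_ae_eq (Lp.aestronglyMeasurable Y').aemeasurable hY').symm

end IsCoherentUtility

theorem memLp_comp {ι : Type*} [Finite ι] [MeasurableSpace ι] [MeasurableSingletonClass ι]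
    {W : Ω → ι} (hW : Measurable W) (y : ι → ℝ) : MemLp (y ∘ W) ⊤ μ := by
  obtain ⟨C, hC⟩ := (Set.finite_range fun i => ‖y i‖).bddAbove
  exact memLp_top_of_bound ((measurable_of_finite y).comp hW).aestronglyMeasurable C
    (.of_forall fun ω => hC ⟨W ω, rfl⟩)

/-- Composition with a finitely valued random variable, as a linear map into `L^∞`. -/
def compLinear {ι : Type*} [Finite ι] [MeasurableSpace ι] [MeasurableSingletonClass ι]
    {W : Ω → ι} (hW : Measurable W) : (ι → ℝ) →ₗ[ℝ] Xinf μ where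
  toFun y := (memLp_comp hW y).toLp _
  map_add' y z := MemLp.toLp_add (memLp_comp hW y) (memLp_comp hW z)
  map_smul' c y := MemLp.toLp_const_smul c (memLp_comp hW y)

theorem compLinear_ae_eq {ι : Type*} [Finite ι] [MeasurableSpace ι] [MeasurableSingletonClass ι]
    {W : Ω → ι} (hW : Measurable W) (y : ι → ℝ) : compLinear (μ := μ) hW y =ᵐ[μ] y ∘ W :=
  MemLp.coeFn_toLp (memLp_comp hW y)

/-- On a finite equiprobable partition, a coherent law-invariant utility is dominated by a
weighted sum with nonincreasing weights which is tight at a prescribed monotone vector. -/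
theorem IsCoherentUtility.exists_weights {U : Xinf μ → ℝ} (hU : IsCoherentUtility U) {N : ℕ}
    {W : Ω → Fin N} (hW : Measurable W) {c : ℝ} (hlaw : ∀ k, μ.real (W ⁻¹' {k}) = c)
    {z : Fin N → ℝ} (hz : Monotone z) :
    ∃ p : Fin N → ℝ, Antitone p ∧ (∀ k, 0 ≤ p k) ∧ ∑ k, p k = 1 ∧
      (∀ y, U (compLinear hW y) ≤ ∑ k, p k * y k) ∧ ∑ k, p k * z k ≤ U (compLinear hW z) := by
  obtain ⟨ℓ, hℓ, hℓz⟩ := hU.exists_supporting (compLinear hW z)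
  set p : Fin N → ℝ := fun k => ℓ (compLinear hW fun j => if k = j then 1 else 0) with hp
  have hsum : ∀ y, ℓ (compLinear hW y) = ∑ k, p k * y k := by
    intro y
    have := (ℓ ∘ₗ compLinear hW).pi_apply_eq_sum_univ y
    simpa [hp, mul_comm] using this
  have hperm : ∀ (y : Fin N → ℝ) (σ : Equiv.Perm (Fin N)),
      U (compLinear hW (y ∘ σ)) = U (compLinear hW y) := by
    intro y σ
    refine hU.law_comp (W := σ ∘ W) (W' := W) ?_ (measurable_of_finite y)
      (compLinear_ae_eq hW (y ∘ σ)) (compLinear_ae_eq hW y)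
    have hσ : Measurable σ := measurable_of_finite σ
    refine ⟨(hσ.comp hW).aemeasurable, hW.aemeasurable, Measure.ext_of_singleton fun k => ?_⟩
    rw [Measure.map_apply (hσ.comp hW) (measurableSet_singleton k),
      Measure.map_apply hW (measurableSet_singleton k)]
    have hpre : σ ∘ W ⁻¹' {k} = W ⁻¹' {σ.symm k} := by
      ext ω
      simp [Equiv.eq_symm_apply]
    rw [hpre, ← measureReal_eq_measureReal_iff, hlaw, hlaw]
  have hp0 : ∀ k, 0 ≤ p k := by
    intro k
    refine le_trans ?_ (hℓ _)
    refine hU.map_zero.symm.trans_le (hU.mono _ _ ((Lp.coeFn_le _ _).1 ?_))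
    filter_upwards [Lp.coeFn_zero ℝ ⊤ μ, compLinear_ae_eq (μ := μ) hW fun j => if k = j then 1 else 0]
      with ω h0 h1
    rw [h0, h1]
    simp only [Pi.zero_apply, Function.comp_apply]
    split_ifs <;> norm_num
  have hconst : ∀ a : ℝ, compLinear (μ := μ) hW (fun _ => a) = Lp.const ⊤ μ a := fun a => rfl
  have hp1 : ∑ k, p k = 1 := by
    have hle := hℓ (compLinear hW fun _ => 1)
    have hge := hℓ (compLinear hW fun _ => -1)
    rw [hconst, hU.map_const, ← hconst, hsum] at hle hge
    simp only [mul_neg, mul_one, Finset.sum_neg_distrib] at hle hge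
    linarith
  set τ := Tuple.sort fun k => -p k
  have hanti : Antitone (p ∘ τ) := fun i j hij =>
    neg_le_neg_iff.1 (Tuple.monotone_sort (fun k => -p k) hij)
  refine ⟨p ∘ τ, hanti, fun k => hp0 _, ?_, fun y => ?_, ?_⟩
  · rw [← hp1]
    exact Equiv.sum_comp τ p
  · rw [← hperm y τ.symm]
    refine (hℓ _).trans_eq ?_
    rw [hsum, ← Equiv.sum_comp τ]
    simp
  · rw [← hℓz, hsum]
    have h := (hanti.antivary hz).sum_mul_le_sum_comp_perm_mul (σ := τ.symm)
    simpa using h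

namespace IsUniform

variable {V : Ω → ℝ}

theorem exists_convexDistortion_step (hV : IsUniform μ V) {U : Xinf μ → ℝ}
    (hU : IsCoherentUtility U) {N : ℕ} (hN : 0 < N) {z : ℕ → ℝ} (hz : Monotone z) :
    ∃ T, IsConvexDistortion T ∧
      (∀ (y : ℕ → ℝ) (Y : Xinf μ), Monotone y → (Y =ᵐ[μ] fun ω => y ⌊N * V ω⌋₊) →
        U Y ≤ choquet μ T fun ω => y ⌊N * V ω⌋₊) ∧
      ∀ Z : Xinf μ, (Z =ᵐ[μ] fun ω => z ⌊N * V ω⌋₊) →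
        (choquet μ T fun ω => z ⌊N * V ω⌋₊) ≤ U Z := by
  set W : Ω → Fin N := fun ω => ⟨⌊N * V ω⌋₊, hV.floor_lt hN ω⟩ with hWdef
  have hpre : ∀ k : Fin N, W ⁻¹' {k} = {ω | ⌊N * V ω⌋₊ = k} := fun k => by
    ext ω
    simp [hWdef, Fin.ext_iff]
  have hW : Measurable W := measurable_to_countable' fun k => by
    rw [hpre]
    exact hV.measurable_floor N (measurableSet_singleton _)
  obtain ⟨p, hp, hp0, hp1, hpU, hpz⟩ := hU.exists_weights hW
    (fun k => by rw [hpre, hV.measureReal_floor_eq hN k.2]) (z := fun k => z k)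
    (fun i j hij => hz hij)
  set P : ℕ → ℝ := fun k => if h : k < N then p ⟨k, h⟩ else 0 with hPdef
  have hPfin : ∀ k : Fin N, P k = p k := fun k => by simp [hPdef]
  have hPanti : Antitone P := by
    intro i j hij
    by_cases hj : j < N
    · simp only [hPdef, hj, hij.trans_lt hj, dif_pos]
      exact hp hij
    · simp only [hPdef, hj, dif_neg, not_false_eq_true]
      split_ifs
      exacts [hp0 _, le_rfl]
  have hPN : P N = 0 := by simp [hPdef]
  obtain ⟨T, hT, hTP⟩ := exists_convexDistortion_of_antitone hN hPanti hPN
    (by rw [Finset.sum_range, ← hp1]; exact Finset.sum_congr rfl fun k _ => hPfin k)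
  have hchoq : ∀ y : ℕ → ℝ, Monotone y →
      choquet μ T (fun ω => y ⌊N * V ω⌋₊) = ∑ k : Fin N, p k * y k := by
    intro y hy
    rw [hV.choquet_step hN hT.1 hy, Finset.sum_range]
    refine Finset.sum_congr rfl fun k _ => ?_
    rw [hTP k k.2, hPfin, mul_comm]
  have hrep : ∀ (y : ℕ → ℝ) (Y : Xinf μ), (Y =ᵐ[μ] fun ω => y ⌊N * V ω⌋₊) →
      Y = compLinear hW fun k => y k := fun y Y hY =>
    Lp.ext (hY.trans (compLinear_ae_eq hW fun k : Fin N => y k).symm)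
  refine ⟨T, hT, fun y Y hy hY => ?_, fun Z hZ => ?_⟩
  · rw [hchoq y hy, hrep y Y hY]
    exact hpU _
  · rw [hchoq z hz, hrep z Z hZ]
    exact hpz

end IsUniform

theorem exists_ae_bound (Y : Xinf μ) : ∃ M : ℝ, ∀ᵐ ω ∂μ, |Y ω| ≤ M := by
  refine ⟨(eLpNormEssSup Y μ).toReal, ?_⟩
  have hfin : eLpNormEssSup Y μ ≠ ⊤ := by
    rw [← eLpNorm_exponent_top]
    exact Lp.eLpNorm_ne_top Y
  filter_upwards [ae_le_eLpNormEssSup (f := (Y : Ω → ℝ)) (μ := μ)] with ω hω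
  rw [← Real.norm_eq_abs, ← toReal_enorm]
  exact ENNReal.toReal_mono hfin hω

theorem exists_Linf {f : Ω → ℝ} (hf : Measurable f) {M : ℝ} (hM : ∀ ω, |f ω| ≤ M) :
    ∃ X : Xinf μ, X =ᵐ[μ] f :=
  ⟨_, MemLp.coeFn_toLp (memLp_top_of_bound hf.aestronglyMeasurable M (.of_forall hM))⟩

/-- Quantile transform: a bounded random variable has the law of a nondecreasing function of a
uniform one. -/
theorem IsUniform.exists_quantile {V : Ω → ℝ} (hV : IsUniform μ V) {f : Ω → ℝ} (hf : Measurable f)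
    {M : ℝ} (hM : ∀ᵐ ω ∂μ, |f ω| ≤ M) :
    ∃ q : ℝ → ℝ, Monotone q ∧ (∀ v, |q v| ≤ M) ∧ IdentDistrib f (q ∘ V) μ μ ∧
      ∀ t, μ.real {ω | t < q (V ω)} = 1 → t ≤ q 0 := by
  have hM0 : 0 ≤ M := by
    obtain ⟨ω, hω⟩ := hM.exists
    exact (abs_nonneg _).trans hω
  have : IsProbabilityMeasure (μ.map f) := Measure.isProbabilityMeasure_map hf.aemeasurable
  set F := cdf (μ.map f) with hF
  have hFmono : Monotone F := monotone_cdf _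
  have hFreal : ∀ x, F x = μ.real {ω | f ω ≤ x} := fun x => by
    rw [hF, cdf_eq_real, map_measureReal_apply hf measurableSet_Iic]
    rfl
  have hF01 : ∀ x, F x ∈ Set.Icc (0 : ℝ) 1 := fun x => by
    rw [hFreal]
    exact ⟨measureReal_nonneg, measureReal_le_one⟩
  set A : ℝ → Set ℝ := fun v => {x | x = M ∨ (-M ≤ x ∧ v < F x)} with hA
  have hMA : ∀ v, M ∈ A v := fun v => Or.inl rfl
  have hlow : ∀ v, ∀ x ∈ A v, -M ≤ x := by
    rintro v x (rfl | h)
    exacts [by linarith, h.1]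
  have hbdd : ∀ v, BddBelow (A v) := fun v => ⟨-M, fun x hx => hlow v x hx⟩
  set q : ℝ → ℝ := fun v => sInf (A v) with hq
  have hqmono : Monotone q := fun v w hvw =>
    csInf_le_csInf (hbdd v) ⟨M, hMA w⟩ fun x hx => hx.imp id fun h => ⟨h.1, hvw.trans_lt h.2⟩
  have hqM : ∀ v, |q v| ≤ M := fun v =>
    abs_le.2 ⟨le_csInf ⟨M, hMA v⟩ (hlow v), csInf_le (hbdd v) (hMA v)⟩
  have hlaw : ∀ x, μ.real {ω | q (V ω) ≤ x} = F x := by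
    intro x
    rcases lt_or_ge x (-M) with hx | hx
    · have h1 : {ω | q (V ω) ≤ x} = ∅ := by
        ext ω
        simp only [Set.mem_ofPred_eq, Set.mem_empty_iff_false, iff_false, not_le]
        exact hx.trans_le (abs_le.1 (hqM _)).1
      have h2 : ∀ᵐ ω ∂μ, ¬ f ω ≤ x := by
        filter_upwards [hM] with ω hω
        exact not_le.2 (hx.trans_le (abs_le.1 hω).1)
      have h3 : μ {ω | f ω ≤ x} = 0 := by simpa [ae_iff] using h2
      rw [h1, hFreal, measureReal_empty, Measure.real, h3, ENNReal.toReal_zero]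
    rcases le_or_gt M x with hx' | hx'
    · have h1 : {ω | q (V ω) ≤ x} = Set.univ := by
        ext ω
        simp only [Set.mem_ofPred_eq, Set.mem_univ, iff_true]
        exact (abs_le.1 (hqM _)).2.trans hx'
      have h2 : {ω | f ω ≤ x} =ᵐ[μ] Set.univ := by
        filter_upwards [hM] with ω hω
        exact propext ⟨fun _ => trivial, fun _ => (abs_le.1 hω).2.trans hx'⟩
      rw [h1, hFreal, measureReal_congr h2]
    have hge : {ω | V ω < F x} ⊆ {ω | q (V ω) ≤ x} := by
      intro ω h
      exact csInf_le (hbdd _) (Or.inr ⟨hx, h⟩)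
    have hle : {ω | q (V ω) ≤ x} ⊆ {ω | V ω ≤ F x} := by
      intro ω (h : q (V ω) ≤ x)
      have hev : ∀ᶠ y in nhdsWithin x (Set.Ioi x), V ω ≤ F y := by
        filter_upwards [Ioo_mem_nhdsGT hx'] with y hy
        obtain ⟨a, ha, hay⟩ := exists_lt_of_csInf_lt ⟨M, hMA _⟩ (h.trans_lt hy.1)
        rcases ha with rfl | ha
        · exact absurd hay hy.2.not_gt
        · exact ha.2.le.trans (hFmono hay.le)
      exact ge_of_tendsto ((F.right_continuous x).mono Set.Ioi_subset_Ici_self) hev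
    refine le_antisymm ?_ ?_
    · rw [← hV.measureReal_le (hF01 x)]
      exact measureReal_mono hle
    · conv_lhs => rw [← hV.law _ (hF01 x)]
      exact measureReal_mono hge
  have hqV : Measurable (q ∘ V) := hqmono.measurable.comp hV.measurable
  refine ⟨q, hqmono, hqM, ⟨hf.aemeasurable, hqV.aemeasurable, ?_⟩, fun t ht => ?_⟩
  · have : IsProbabilityMeasure (μ.map (q ∘ V)) :=
      Measure.isProbabilityMeasure_map hqV.aemeasurable
    refine Measure.eq_of_cdf _ _ (StieltjesFunction.ext fun x => ?_)
    rw [cdf_eq_real (μ.map (q ∘ V)), map_measureReal_apply hqV measurableSet_Iic]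
    exact (hlaw x).symm
  · have hFt : F t = 0 := by
      have hcompl : {ω | t < q (V ω)} = {ω | q (V ω) ≤ t}ᶜ := by
        ext ω
        change t < q (V ω) ↔ ¬ q (V ω) ≤ t
        exact not_le.symm
      have hm : MeasurableSet {ω | q (V ω) ≤ t} := hqV measurableSet_Iic
      rw [hcompl, probReal_compl_eq_one_sub hm, hlaw] at ht
      linarith
    refine le_csInf ⟨M, hMA 0⟩ ?_
    rintro x (rfl | ⟨-, hx⟩)
    · by_contra hlt
      have : {ω | t < q (V ω)} = ∅ := by
        ext ω
        simp only [Set.mem_ofPred_eq, Set.mem_empty_iff_false, iff_false, not_lt]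
        exact (abs_le.1 (hqM _)).2.trans (not_le.1 hlt).le
      simp [this] at ht
    · exact (hFmono.reflect_lt (hFt.trans_lt hx)).le

/-- The upper dyadic discretisation of `q`. -/
def upperStep (q : ℝ → ℝ) (n k : ℕ) : ℝ := q (((k : ℝ) + 1) / (2 ^ n : ℕ))

/-- The lower dyadic discretisation of `q`. -/
def lowerStep (q : ℝ → ℝ) (n k : ℕ) : ℝ := q ((k : ℝ) / (2 ^ n : ℕ))

theorem monotone_upperStep {q : ℝ → ℝ} (hq : Monotone q) (n : ℕ) : Monotone (upperStep q n) :=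
  fun i j hij => hq (by gcongr)

theorem monotone_lowerStep {q : ℝ → ℝ} (hq : Monotone q) (n : ℕ) : Monotone (lowerStep q n) :=
  fun i j hij => hq (by gcongr)

theorem le_upperStep_floor {q : ℝ → ℝ} (hq : Monotone q) (n : ℕ) (v : ℝ) :
    q v ≤ upperStep q n ⌊(2 ^ n : ℕ) * v⌋₊ := by
  refine hq ?_
  rw [le_div_iff₀' (by positivity)]
  exact (Nat.lt_floor_add_one _).le

theorem lowerStep_floor_le {q : ℝ → ℝ} (hq : Monotone q) (n : ℕ) {v : ℝ} (hv : 0 ≤ v) :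
    lowerStep q n ⌊(2 ^ n : ℕ) * v⌋₊ ≤ q v := by
  refine hq ?_
  rw [div_le_iff₀' (by positivity)]
  exact Nat.floor_le (by positivity)

theorem floor_two_pow_eq_div {m n : ℕ} (hmn : m ≤ n) (v : ℝ) :
    ⌊(2 ^ m : ℕ) * v⌋₊ = ⌊(2 ^ n : ℕ) * v⌋₊ / 2 ^ (n - m) := by
  rw [← Nat.floor_div_natCast]
  congr 1
  rw [← Nat.sub_add_cancel hmn, pow_add]
  simp
  field_simp

theorem lowerStep_floor_mono {q : ℝ → ℝ} (hq : Monotone q) {m n : ℕ} (hmn : m ≤ n) (v : ℝ) :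
    lowerStep q m ⌊(2 ^ m : ℕ) * v⌋₊ ≤ lowerStep q n ⌊(2 ^ n : ℕ) * v⌋₊ := by
  refine hq ?_
  rw [floor_two_pow_eq_div hmn v, div_le_div_iff₀ (by positivity) (by positivity)]
  set k := ⌊(2 ^ n : ℕ) * v⌋₊
  have h := Nat.mul_le_mul_right (2 ^ m) (Nat.div_mul_le_self k (2 ^ (n - m)))
  rw [mul_assoc, ← pow_add, Nat.sub_add_cancel hmn] at h
  exact_mod_cast h

theorem tendsto_lowerStep_floor {q : ℝ → ℝ} {v : ℝ} (hv : 0 ≤ v) (hq : ContinuousAt q v) :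
    Tendsto (fun n : ℕ => lowerStep q n ⌊(2 ^ n : ℕ) * v⌋₊) atTop (nhds (q v)) := by
  refine hq.tendsto.comp ?_
  have h : Tendsto (fun n : ℕ => ((2 ^ n : ℕ) : ℝ)) atTop atTop :=
    tendsto_natCast_atTop_atTop.comp (tendsto_pow_atTop_atTop_of_one_lt one_lt_two)
  have := (tendsto_nat_floor_mul_div_atTop hv).comp h
  simpa only [Function.comp_def, mul_comm v] using this

theorem tendsto_upperStep_floor {q : ℝ → ℝ} {v : ℝ} (hv : 0 ≤ v) (hq : ContinuousAt q v) :
    Tendsto (fun n : ℕ => upperStep q n ⌊(2 ^ n : ℕ) * v⌋₊) atTop (nhds (q v)) := by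
  refine hq.tendsto.comp ?_
  have h : Tendsto (fun n : ℕ => ((2 ^ n : ℕ) : ℝ)) atTop atTop :=
    tendsto_natCast_atTop_atTop.comp (tendsto_pow_atTop_atTop_of_one_lt one_lt_two)
  have := ((tendsto_nat_floor_mul_div_atTop hv).add tendsto_inv_atTop_zero).comp h
  simpa only [Function.comp_def, mul_comm v, add_zero, add_div, one_div] using this

theorem IsCoherentUtility.le_of_ae {U : Xinf μ → ℝ} (hU : IsCoherentUtility U) {X Y : Xinf μ}
    {f g : Ω → ℝ} (hX : X =ᵐ[μ] f) (hY : Y =ᵐ[μ] g) (h : ∀ ω, f ω ≤ g ω) : U X ≤ U Y := by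
  refine hU.mono X Y ((Lp.coeFn_le X Y).1 ?_)
  filter_upwards [hX, hY] with ω h1 h2
  rw [h1, h2]
  exact h ω

theorem isConvexDistortion_of_tendsto {ι : Type*} {l : Filter ι} [l.NeBot] {T : ι → ℝ → ℝ}
    {T' : ℝ → ℝ} (hT : ∀ i, IsConvexDistortion (T i))
    (h : ∀ x ∈ Set.Icc (0 : ℝ) 1, Tendsto (fun i => T i x) l (nhds (T' x))) :
    IsConvexDistortion T' := by
  have h01 : ∀ x ∈ Set.Icc (0 : ℝ) 1, T' x ∈ Set.Icc (0 : ℝ) 1 := fun x hx =>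
    isClosed_Icc.mem_of_tendsto (h x hx) (.of_forall fun i => (hT i).1.2.1 x hx)
  refine ⟨⟨fun x hx y hy hxy => ?_, h01, ?_, ?_⟩, convex_Icc 0 1, fun x hx y hy a b ha hb hab => ?_⟩
  · exact le_of_tendsto_of_tendsto' (h x hx) (h y hy) fun i => (hT i).1.1 hx hy hxy
  · refine tendsto_nhds_unique (h 0 (by simp)) ?_
    simp only [(hT _).1.2.2.1, tendsto_const_nhds]
  · refine tendsto_nhds_unique (h 1 (by simp)) ?_
    simp only [(hT _).1.2.2.2, tendsto_const_nhds]
  · refine le_of_tendsto_of_tendsto' (h _ (convex_Icc 0 1 hx hy ha hb hab))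
      (((h x hx).const_smul a).add ((h y hy).const_smul b)) fun i => ?_
    obtain ⟨-, hc⟩ := (hT i).2
    exact hc hx hy ha hb hab

/-- Convex distortions form a compact set for pointwise convergence on `[0, 1]`. -/
theorem exists_tendsto_convexDistortion {ι : Type*} (l : Ultrafilter ι) {T : ι → ℝ → ℝ}
    (hT : ∀ i, IsConvexDistortion (T i)) :
    ∃ T', IsConvexDistortion T' ∧
      ∀ x ∈ Set.Icc (0 : ℝ) 1, Tendsto (fun i => T i x) l (nhds (T' x)) := by
  have h : ∀ x, ∃ y, x ∈ Set.Icc (0 : ℝ) 1 → Tendsto (fun i => T i x) l (nhds y) := by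
    intro x
    by_cases hx : x ∈ Set.Icc (0 : ℝ) 1
    · obtain ⟨y, -, hy⟩ := isCompact_Icc.ultrafilter_le_nhds' (l.map fun i => T i x)
        (Ultrafilter.mem_map.2 (Filter.univ_mem' fun i => (hT i).1.2.1 x hx))
      exact ⟨y, fun _ => hy⟩
    · exact ⟨0, fun h => absurd h hx⟩
  choose T' hT' using h
  exact ⟨T', isConvexDistortion_of_tendsto hT hT', hT'⟩

namespace IsUniform

variable {V : Ω → ℝ}

theorem tendsto_choquet_step (hV : IsUniform μ V) {ι : Type*} {l : Filter ι} {T : ι → ℝ → ℝ}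
    {T' : ℝ → ℝ} (hT : ∀ i, IsDistortion (T i)) (hT' : IsDistortion T')
    (h : ∀ x ∈ Set.Icc (0 : ℝ) 1, Tendsto (fun i => T i x) l (nhds (T' x))) {N : ℕ} (hN : 0 < N)
    {y : ℕ → ℝ} (hy : Monotone y) :
    Tendsto (fun i => choquet μ (T i) fun ω => y ⌊N * V ω⌋₊) l
      (nhds (choquet μ T' fun ω => y ⌊N * V ω⌋₊)) := by
  have hN' : (0 : ℝ) < N := by exact_mod_cast hN
  simp only [hV.choquet_step hN (hT _) hy, hV.choquet_step hN hT' hy]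
  refine tendsto_finsetSum _ fun k hk => ?_
  have hk' : (k : ℝ) + 1 ≤ N := by exact_mod_cast Finset.mem_range.1 hk
  have hk0 : (0 : ℝ) ≤ k := Nat.cast_nonneg k
  refine ((h _ ⟨?_, ?_⟩).sub (h _ ⟨?_, ?_⟩)).const_mul _
  · exact div_nonneg (by linarith) hN'.le
  · exact div_le_one_of_le₀ (by linarith) hN'.le
  · exact div_nonneg (by linarith) hN'.le
  · exact div_le_one_of_le₀ (by linarith) hN'.le

theorem tendsto_choquet_upperStep (hV : IsUniform μ V) {T : ℝ → ℝ} (hT : IsConvexDistortion T)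
    {q : ℝ → ℝ} (hq : Monotone q) {M : ℝ} (hM : ∀ v, |q v| ≤ M) :
    Tendsto (fun n : ℕ => choquet μ T fun ω => upperStep q n ⌊(2 ^ n : ℕ) * V ω⌋₊) atTop
      (nhds (choquet μ T (q ∘ V))) := by
  refine hT.tendsto_choquet (M := M) (fun n => hV.measurable_step _ _)
    (hq.measurable.comp hV.measurable) (fun n => .of_forall fun ω => hM _)
    (.of_forall fun ω => hM _) ?_ (.of_forall fun t ht n => ?_)
  · filter_upwards [hV.ae_notMem hq.countable_not_continuousAt] with ω hω
    exact tendsto_upperStep_floor (hV.mem_Ico ω).1 (not_not.1 hω)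
  · refine le_antisymm measureReal_le_one ?_
    rw [← ht]
    refine measureReal_mono ?_
    intro ω h
    exact lt_of_lt_of_le h (le_upperStep_floor hq n (V ω))

theorem tendsto_choquet_lowerStep (hV : IsUniform μ V) {T : ℝ → ℝ} (hT : IsConvexDistortion T)
    {q : ℝ → ℝ} (hq : Monotone q) {M : ℝ} (hM : ∀ v, |q v| ≤ M)
    (hq0 : ∀ t, μ.real {ω | t < q (V ω)} = 1 → t ≤ q 0) :
    Tendsto (fun n : ℕ => choquet μ T fun ω => lowerStep q n ⌊(2 ^ n : ℕ) * V ω⌋₊) atTop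
      (nhds (choquet μ T (q ∘ V))) := by
  refine hT.tendsto_choquet (M := M) (fun n => hV.measurable_step _ _)
    (hq.measurable.comp hV.measurable) (fun n => .of_forall fun ω => hM _)
    (.of_forall fun ω => hM _) ?_ ?_
  · filter_upwards [hV.ae_notMem hq.countable_not_continuousAt] with ω hω
    exact tendsto_lowerStep_floor (hV.mem_Ico ω).1 (not_not.1 hω)
  · filter_upwards [(Set.countable_singleton (q 0)).ae_notMem volume] with t hne ht n
    have hlt : t < q 0 := lt_of_le_of_ne (hq0 t ht) hne
    have : {ω | t < lowerStep q n ⌊(2 ^ n : ℕ) * V ω⌋₊} = Set.univ := by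
      ext ω
      simp only [Set.mem_ofPred_eq, Set.mem_univ, iff_true]
      exact hlt.trans_le (hq (by positivity))
    rw [this, probReal_univ]

/-- A dominating convex distortion that is tight at a given random variable. -/
theorem exists_convexDistortion (hV : IsUniform μ V) {U : Xinf μ → ℝ} (hU : IsCoherentUtility U)
    (Z : Xinf μ) :
    ∃ T, IsConvexDistortion T ∧ (∀ Y, U Y ≤ choquetLp μ T Y) ∧ choquetLp μ T Z ≤ U Z := by
  have hrep : ∀ Y : Xinf μ, ∃ (q : ℝ → ℝ) (M : ℝ) (X : Xinf μ), Monotone q ∧ (∀ v, |q v| ≤ M) ∧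
      (X =ᵐ[μ] q ∘ V) ∧ U Y = U X ∧ (∀ T, choquetLp μ T Y = choquet μ T (q ∘ V)) ∧
      ∀ t, μ.real {ω | t < q (V ω)} = 1 → t ≤ q 0 := by
    intro Y
    obtain ⟨M, hM⟩ := exists_ae_bound Y
    obtain ⟨q, hq, hqM, hid, hq0⟩ := hV.exists_quantile (Lp.stronglyMeasurable Y).measurable hM
    obtain ⟨X, hX⟩ := exists_Linf (μ := μ) (hq.measurable.comp hV.measurable) fun ω => hqM (V ω)
    refine ⟨q, M, X, hq, hqM, hX, hU.law_comp hid measurable_id (f := id) .rfl hX, fun T => ?_, hq0⟩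
    exact choquet_congr_tail fun t => congrArg ENNReal.toReal (hid.measure_mem_eq measurableSet_Ioi)
  obtain ⟨qZ, MZ, Z', hqZ, hMZ, hZ', hUZ, hcZ, hqZ0⟩ := hrep Z
  have hpow : ∀ n : ℕ, 0 < 2 ^ n := fun n => by positivity
  choose T hT hTle hTge using fun n =>
    hV.exists_convexDistortion_step hU (hpow n) (monotone_lowerStep hqZ n)
  obtain ⟨T', hT', hlim⟩ := exists_tendsto_convexDistortion (hyperfilter ℕ) hT
  have hstep : ∀ (m : ℕ) {y : ℕ → ℝ}, Monotone y →
      Tendsto (fun n => choquet μ (T n) fun ω => y ⌊(2 ^ m : ℕ) * V ω⌋₊) (hyperfilter ℕ)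
        (nhds (choquet μ T' fun ω => y ⌊(2 ^ m : ℕ) * V ω⌋₊)) := fun m y hy =>
    hV.tendsto_choquet_step (fun n => (hT n).1) hT'.1 hlim (hpow m) hy
  have hge : ∀ m : ℕ, ∀ᶠ n in (hyperfilter ℕ : Filter ℕ), m ≤ n := fun m =>
    Nat.hyperfilter_le_atTop (eventually_ge_atTop m)
  refine ⟨T', hT', fun Y => ?_, ?_⟩
  · obtain ⟨q, M, X, hq, hM, hX, hUY, hcY, -⟩ := hrep Y
    rw [hUY, hcY]
    refine ge_of_tendsto' (hV.tendsto_choquet_upperStep hT' hq hM) fun m => ?_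
    have hmono := monotone_upperStep hq m
    refine ge_of_tendsto (hstep m hmono) ?_
    filter_upwards [hge m] with n hmn
    obtain ⟨Xm, hXm⟩ := exists_Linf (μ := μ) (hV.measurable_step (2 ^ m) (upperStep q m))
      fun ω => hM _
    refine (hU.le_of_ae hX hXm fun ω => le_upperStep_floor hq m (V ω)).trans ?_
    have hdiv : ∀ ω, upperStep q m ⌊(2 ^ m : ℕ) * V ω⌋₊ =
        upperStep q m (⌊(2 ^ n : ℕ) * V ω⌋₊ / 2 ^ (n - m)) := fun ω => by
      rw [floor_two_pow_eq_div hmn]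
    simp only [hdiv] at hXm ⊢
    exact hTle n (fun k => upperStep q m (k / 2 ^ (n - m))) Xm
      (fun i j hij => hmono (Nat.div_le_div_right hij)) hXm
  · rw [hUZ, hcZ]
    refine le_of_tendsto' (hV.tendsto_choquet_lowerStep hT' hqZ hMZ hqZ0) fun m => ?_
    refine le_of_tendsto (hstep m (monotone_lowerStep hqZ m)) ?_
    filter_upwards [hge m] with n hmn
    obtain ⟨Zn, hZn⟩ := exists_Linf (μ := μ) (hV.measurable_step (2 ^ n) (lowerStep qZ n))
      fun ω => hMZ _
    calc choquet μ (T n) (fun ω => lowerStep qZ m ⌊(2 ^ m : ℕ) * V ω⌋₊)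
        ≤ choquet μ (T n) (fun ω => lowerStep qZ n ⌊(2 ^ n : ℕ) * V ω⌋₊) :=
          (hT n).1.choquet_mono (M := MZ) (.of_forall fun ω => hMZ _) (.of_forall fun ω => hMZ _)
            (.of_forall fun ω => lowerStep_floor_mono hqZ hmn (V ω))
      _ ≤ U Zn := hTge n Zn hZn
      _ ≤ U Z' := hU.le_of_ae hZn hZ' fun ω => lowerStep_floor_le hqZ n (hV.mem_Ico ω).1

end IsUniform

theorem IsDistortion.convexComb {T₁ T₂ : ℝ → ℝ} (h₁ : IsDistortion T₁) (h₂ : IsDistortion T₂)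
    {a b : ℝ} (ha : 0 ≤ a) (hb : 0 ≤ b) (hab : a + b = 1) : IsDistortion (a • T₁ + b • T₂) := by
  refine ⟨fun x hx y hy hxy => ?_, fun x hx => ?_, ?_, ?_⟩
  · exact add_le_add (mul_le_mul_of_nonneg_left (h₁.1 hx hy hxy) ha)
      (mul_le_mul_of_nonneg_left (h₂.1 hx hy hxy) hb)
  · exact convex_Icc 0 1 (h₁.2.1 x hx) (h₂.2.1 x hx) ha hb hab
  · simp [h₁.2.2.1, h₂.2.2.1]
  · simpa [h₁.2.2.2, h₂.2.2.2] using hab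

theorem IsDistortion.choquetLp_convexComb {T₁ T₂ : ℝ → ℝ} (h₁ : IsDistortion T₁)
    (h₂ : IsDistortion T₂) {a b : ℝ} (ha : 0 ≤ a) (hb : 0 ≤ b) (hab : a + b = 1) (Y : Xinf μ) :
    choquetLp μ (a • T₁ + b • T₂) Y = a * choquetLp μ T₁ Y + b * choquetLp μ T₂ Y := by
  obtain ⟨M, hM⟩ := exists_ae_bound Y
  simp only [choquetLp]
  rw [h₁.choquet_eq hM, h₂.choquet_eq hM, (h₁.convexComb h₂ ha hb hab).choquet_eq hM]
  simp only [Pi.add_apply, Pi.smul_apply, smul_eq_mul]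
  rw [intervalIntegral.integral_add ((h₁.tail_antitone _).intervalIntegrable.const_mul a)
    ((h₂.tail_antitone _).intervalIntegrable.const_mul b), intervalIntegral.integral_const_mul,
    intervalIntegral.integral_const_mul]
  linear_combination M * hab

/-- A law-invariant positively homogeneous monetary utility admits, on the set
of random variables comonotone with `S`, a representation as an infimum of Choquet integrals
over a convex set of convex distortion functions which is sequentially closed under pointwise
convergence. -/
theorem representation_on_comonotone_cone
    (hatomless : AtomlessMeasure μ) (S : Xinf μ) (U : Xinf μ → ℝ)
    (hmono : UMonotone U) (hconc : ConcaveOn ℝ Set.univ U)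
    (htrans : TranslationInvariant U) (hlaw : LawInvariant U)
    (hph : PositivelyHomogeneous U) :
    ∃ 𝒯 : Set (ℝ → ℝ), (∀ T ∈ 𝒯, IsConvexDistortion T) ∧ Convex ℝ 𝒯 ∧
      SeqClosedPointwise 𝒯 ∧
      ∀ Z : Xinf μ, ComonotonePairLp Z S →
        U Z = sInf ((fun T => choquetLp μ T Z) '' 𝒯) := by
  have hU : IsCoherentUtility U := ⟨hmono, hconc, htrans, hlaw, hph⟩
  obtain ⟨V, hVm, hV01, hVlaw⟩ := hatomless.exists_uniform
  have hV : IsUniform μ V := ⟨hVm, hV01, hVlaw⟩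
  refine ⟨{T | IsConvexDistortion T ∧ ∀ Y : Xinf μ, U Y ≤ choquetLp μ T Y}, fun T hT => hT.1,
    ?_, ?_, fun Z _ => ?_⟩
  · rintro T₁ ⟨h₁, hU₁⟩ T₂ ⟨h₂, hU₂⟩ a b ha hb hab
    refine ⟨⟨h₁.1.convexComb h₂.1 ha hb hab, (h₁.2.smul ha).add (h₂.2.smul hb)⟩, fun Y => ?_⟩
    rw [h₁.1.choquetLp_convexComb h₂.1 ha hb hab]
    calc U Y = a * U Y + b * U Y := by rw [← add_mul, hab, one_mul]
      _ ≤ _ := add_le_add (mul_le_mul_of_nonneg_left (hU₁ Y) ha)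
        (mul_le_mul_of_nonneg_left (hU₂ Y) hb)
  · intro T T' hT hlim
    have hT' : IsConvexDistortion T' :=
      isConvexDistortion_of_tendsto (fun k => (hT k).1) fun x _ => hlim x
    refine ⟨hT', fun Y => ?_⟩
    obtain ⟨M, hM⟩ := exists_ae_bound Y
    exact ge_of_tendsto' (tendsto_choquet (fun k => (hT k).1.1) hT'.1 (fun _ => hM) hM
      (.of_forall fun t => hlim _)) fun k => (hT k).2 Y
  · obtain ⟨T, hT, hTU, hTZ⟩ := hV.exists_convexDistortion hU Z
    have hmem : U Z ∈ (fun T => choquetLp μ T Z) ''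
        {T | IsConvexDistortion T ∧ ∀ Y : Xinf μ, U Y ≤ choquetLp μ T Y} :=
      ⟨T, ⟨hT, hTU⟩, le_antisymm hTZ (hTU Z)⟩
    refine (IsLeast.csInf_eq (And.intro hmem ?_)).symm
    rintro _ ⟨T', ⟨-, hT'⟩, rfl⟩
    exact hT' Z

end
end

section
/- Suppose each U_i is a concave dual utility functional, i.e., U_i(Z) = ∫ Z d(T_i∘ℙ) for a convex distortion function T_i. For x ≥ 0 let L_x := {i : T_i(ℙ(S > s̲ + x)) = max_j T_j(ℙ(S > s̲ + x))}. Let h_i : ℝ₊ → [0,1] be measurable functions with ∑_{i∈L_x} h_i(x) = 1 and ∑_{i∉L_x} h_i(x) = 0 for almost every x, set g*_i(x) := ∫_0^x h_i(z) dz, and let c*_1,…,c*_n ∈ ℝ with ∑ c*_i = s̲ be such that the allocation (g*_i(S − s̲) + c*_i)_{i=1}^n is individually rational. Then the supremum of ∑_{i=1}^n U_i(Y_i) over IR comonotone allocations equals ∑_{i=1}^n U_i(g*_i(S − s̲) + c*_i), which equals s̲ + ∫_0^∞ max_i T_i(ℙ(S > s̲ + x)) dx; in particular (g*_i(S − s̲)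 + c*_i)_i is comonotone Pareto optimal. Conversely, every maximizer (Y*_i) of ∑_{i=1}^n U_i(Y_i) over IR comonotone allocations is of the form Y*_i = g*_i(S − s̲) + c*_i with g*_i and c*_i as above. -/
open MeasureTheory ProbabilityTheory Filter

noncomputable section

variable {Ω : Type*} [MeasurableSpace Ω] (μ : MeasureTheory.Measure Ω) [MeasureTheory.IsProbabilityMeasure μ]

variable {μ}

theorem intervalIntegrable_of_mem_Icc {h : ℝ → ℝ} (hm : Measurable h)
    (hr : ∀ x, h x ∈ Set.Icc (0:ℝ) 1) (a b : ℝ) : IntervalIntegrable h volume a b :=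
  (intervalIntegrable_const (c := (1:ℝ))).mono_fun hm.aestronglyMeasurable
    (Eventually.of_forall fun x => by
      simpa [abs_of_nonneg (hr x).1] using (hr x).2)

theorem monotone_primitive {h : ℝ → ℝ} (hm : Measurable h)
    (hr : ∀ x, h x ∈ Set.Icc (0:ℝ) 1) : Monotone fun x => ∫ z in (0:ℝ)..x, h z := by
  intro x y hxy
  have := intervalIntegral.integral_interval_sub_left
    (intervalIntegrable_of_mem_Icc hm hr 0 y) (intervalIntegrable_of_mem_Icc hm hr 0 x)
  have h0 := intervalIntegral.integral_nonneg hxy (fun u _ => (hr u).1) (μ := volume)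
  dsimp only
  linarith

theorem continuous_primitive_of_mem_Icc {h : ℝ → ℝ} (hm : Measurable h)
    (hr : ∀ x, h x ∈ Set.Icc (0:ℝ) 1) : Continuous fun x => ∫ z in (0:ℝ)..x, h z :=
  intervalIntegral.continuous_primitive (intervalIntegrable_of_mem_Icc hm hr) 0

theorem setLIntegral_Ioc_ofReal {h : ℝ → ℝ} (hm : Measurable h)
    (hr : ∀ x, h x ∈ Set.Icc (0:ℝ) 1) {x : ℝ} (hx : 0 ≤ x) :
    ∫⁻ z in Set.Ioc 0 x, ENNReal.ofReal (h z) = ENNReal.ofReal (∫ z in (0:ℝ)..x, h z) := by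
  rw [intervalIntegral.integral_of_le hx, ofReal_integral_eq_lintegral_ofReal
    (intervalIntegrable_of_mem_Icc hm hr 0 x).1 (Eventually.of_forall fun z => (hr z).1)]

/-- The primitive of `h` pushes the measure with density `h` to Lebesgue measure. -/
theorem map_primitive_withDensity {h : ℝ → ℝ} (hm : Measurable h)
    (hr : ∀ x, h x ∈ Set.Icc (0:ℝ) 1) {M : ℝ} (hM : 0 ≤ M) :
    ((volume.restrict (Set.Ioc 0 M)).withDensity fun x => ENNReal.ofReal (h x)).map
        (fun x => ∫ z in (0:ℝ)..x, h z) =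
      volume.restrict (Set.Ioc 0 (∫ z in (0:ℝ)..M, h z)) := by
  have hmono := monotone_primitive hm hr
  have hcont := continuous_primitive_of_mem_Icc hm hr
  set g : ℝ → ℝ := fun x => ∫ z in (0:ℝ)..x, h z with hg
  have g0 : g 0 = 0 := by simp [hg]
  change Measure.map g _ = volume.restrict (Set.Ioc 0 (g M))
  symm
  apply Measure.ext_of_Iic
  intro a
  rw [Measure.map_apply hcont.measurable measurableSet_Iic,
    withDensity_apply _ (hcont.measurable measurableSet_Iic),
    Measure.restrict_restrict (hcont.measurable measurableSet_Iic),
    Measure.restrict_apply measurableSet_Iic]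
  rcases lt_or_ge a 0 with ha | ha
  · have h1 : g ⁻¹' Set.Iic a ∩ Set.Ioc 0 M = ∅ := by
      ext x
      simp only [Set.mem_inter_iff, Set.mem_preimage, Set.mem_Iic, Set.mem_Ioc,
        Set.mem_empty_iff_false, iff_false]
      rintro ⟨h1, h2, -⟩
      linarith [hmono h2.le]
    have h2 : Set.Iic a ∩ Set.Ioc 0 (g M) = ∅ := by
      ext x
      simp only [Set.mem_inter_iff, Set.mem_Iic, Set.mem_Ioc,
        Set.mem_empty_iff_false, iff_false]
      rintro ⟨h1, h2, -⟩
      linarith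
    rw [h1, h2]
    simp
  · have hK : IsCompact (Set.Icc 0 M ∩ g ⁻¹' Set.Iic a) :=
      isCompact_Icc.inter_right (isClosed_Iic.preimage hcont)
    obtain ⟨x, ⟨⟨hx0, hxM⟩, hxa⟩, hub⟩ :=
      hK.exists_isGreatest ⟨0, ⟨le_rfl, hM⟩, by simpa [g0] using ha⟩
    have hgx : g x = min a (g M) := by
      apply le_antisymm (le_min hxa (hmono hxM))
      by_contra! hlt
      have hmem : min a (g M) ∈ Set.Icc (g x) (g M) := ⟨hlt.le, min_le_right a (g M)⟩
      obtain ⟨y, ⟨hy1, hy2⟩, hy⟩ := intermediate_value_Icc hxM hcont.continuousOn hmem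
      have : y ≤ x := hub ⟨⟨hx0.trans hy1, hy2⟩, by
        rw [Set.mem_preimage, hy, Set.mem_Iic]; exact min_le_left _ _⟩
      exact absurd ((hmono this).trans_lt hlt) (by rw [hy]; exact lt_irrefl _)
    have h1 : g ⁻¹' Set.Iic a ∩ Set.Ioc 0 M = Set.Ioc 0 x := by
      ext z
      constructor
      · rintro ⟨hz1, hz2, hz3⟩
        exact ⟨hz2, hub ⟨⟨hz2.le, hz3⟩, hz1⟩⟩
      · rintro ⟨hz1, hz2⟩
        exact ⟨(hmono hz2).trans hxa, hz1, hz2.trans hxM⟩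
    have h2 : Set.Iic a ∩ Set.Ioc 0 (g M) = Set.Ioc 0 (g x) := by
      ext z
      rw [hgx]
      simp only [Set.mem_inter_iff, Set.mem_Iic, Set.mem_Ioc, le_min_iff]
      tauto
    rw [h1, h2, setLIntegral_Ioc_ofReal hm hr hx0]
    simp [hg]

/-- A primitive increases strictly to the right of almost every point where the integrand does
not vanish. -/
theorem ae_eq_zero_or_primitive_lt {h : ℝ → ℝ} (hm : Measurable h)
    (hr : ∀ x, h x ∈ Set.Icc (0:ℝ) 1) :
    ∀ᵐ x, h x = 0 ∨ ∀ y > x, ∫ z in (0:ℝ)..x, h z < ∫ z in (0:ℝ)..y, h z := by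
  have hmono := monotone_primitive hm hr
  have hloc : LocallyIntegrable h volume :=
    (locallyIntegrable_const (1:ℝ)).mono hm.aestronglyMeasurable
      (Eventually.of_forall fun x => by simpa [abs_of_nonneg (hr x).1] using (hr x).2)
  filter_upwards [LocallyIntegrable.ae_hasDerivAt_integral hloc] with x hx
  by_contra! hcon
  obtain ⟨hne, y, hy, hle⟩ := hcon
  have hx0 : x ∈ Set.Icc x y := ⟨le_rfl, hy.le⟩
  refine hne ((uniqueDiffOn_Icc hy x hx0).eq_deriv _ (hx 0).hasDerivWithinAt
    ((hasDerivWithinAt_const x _ (∫ z in (0:ℝ)..x, h z)).congr ?_ rfl))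
  intro z hz
  exact le_antisymm ((hmono hz.2).trans hle) (hmono hz.1)

theorem setIntegral_Ioc_comp_primitive {h : ℝ → ℝ} (hm : Measurable h)
    (hr : ∀ x, h x ∈ Set.Icc (0:ℝ) 1) {M : ℝ} (hM : 0 ≤ M) {F : ℝ → ℝ} (hF : Measurable F) :
    ∫ t in Set.Ioc 0 (∫ z in (0:ℝ)..M, h z), F t =
      ∫ x in Set.Ioc 0 M, F (∫ z in (0:ℝ)..x, h z) * h x := by
  rw [← map_primitive_withDensity hm hr hM, integral_map
    (continuous_primitive_of_mem_Icc hm hr).aemeasurable hF.aestronglyMeasurable,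
    integral_withDensity_eq_integral_toReal_smul hm.ennreal_ofReal
      (Eventually.of_forall fun _ => ENNReal.ofReal_lt_top)]
  congr with x
  rw [ENNReal.toReal_ofReal (hr x).1, smul_eq_mul, mul_comm]

theorem setIntegral_Ioi_eq_setIntegral_Ioc {f : ℝ → ℝ} {a b : ℝ} (hf : ∀ x, b < x → f x = 0) :
    ∫ x in Set.Ioi a, f x = ∫ x in Set.Ioc a b, f x := by
  refine setIntegral_eq_of_subset_of_forall_sdiff_eq_zero measurableSet_Ioi
    Set.Ioc_subset_Ioi_self ?_
  rintro x ⟨hx0, hx⟩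
  exact hf x (lt_of_not_ge fun hle => hx ⟨hx0, hle⟩)

theorem toReal_measure_mem_Icc (s : Set Ω) : (μ s).toReal ∈ Set.Icc (0:ℝ) 1 :=
  ⟨ENNReal.toReal_nonneg, measureReal_le_one⟩

theorem IsDistortion.antitone_tail {T : ℝ → ℝ} (hT : IsDistortion T) (V : Ω → ℝ) :
    Antitone fun t : ℝ => T (μ {ω | t < V ω}).toReal := fun _ _ hab =>
  hT.1 (toReal_measure_mem_Icc _) (toReal_measure_mem_Icc _)
    (measureReal_mono fun _ hω => lt_of_le_of_lt hab hω)

theorem IsDistortion.tail_eq_zero {T : ℝ → ℝ} (hT : IsDistortion T) {ν : Measure Ω}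
    {V : Ω → ℝ} {t : ℝ} (hV : ∀ᵐ ω ∂ν, V ω ≤ t) : T (ν {ω | t < V ω}).toReal = 0 := by
  have : ν {ω | t < V ω} = 0 := by
    rw [ae_iff] at hV
    simpa using hV
  rw [this, ENNReal.toReal_zero, hT.2.2.1]

theorem IsDistortion.tail_eq_one {T : ℝ → ℝ} (hT : IsDistortion T) {V : Ω → ℝ} {t : ℝ}
    (hV : ∀ᵐ ω ∂μ, t < V ω) : T (μ {ω | t < V ω}).toReal = 1 := by
  have : μ {ω | t < V ω} = 1 := by
    rw [← measure_univ (μ := μ)]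
    apply measure_congr
    filter_upwards [hV] with ω hω
    exact propext ⟨fun _ => trivial, fun _ => hω⟩
  rw [this, ENNReal.toReal_one, hT.2.2.2]

/-- Layer-cake formula for a nondecreasing `1`-Lipschitz transform of a bounded variable. -/
theorem integral_tail_primitive {T : ℝ → ℝ} (hT : IsDistortion T) {h : ℝ → ℝ} (hm : Measurable h)
    (hr : ∀ x, h x ∈ Set.Icc (0:ℝ) 1) {V : Ω → ℝ} {M : ℝ} (hM : 0 ≤ M)
    (hV : ∀ᵐ ω ∂μ, V ω ≤ M) :
    ∫ t in Set.Ioi (0:ℝ), T (μ {ω | t < ∫ z in (0:ℝ)..V ω, h z}).toReal =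
      ∫ x in Set.Ioi (0:ℝ), T (μ {ω | x < V ω}).toReal * h x := by
  have hmono := monotone_primitive hm hr
  rw [setIntegral_Ioi_eq_setIntegral_Ioc (b := ∫ z in (0:ℝ)..M, h z) fun t ht =>
      hT.tail_eq_zero (hV.mono fun ω hω => (hmono hω).trans ht.le),
    setIntegral_Ioi_eq_setIntegral_Ioc (b := M) fun x hx => by
      rw [hT.tail_eq_zero (hV.mono fun ω hω => hω.trans hx.le), zero_mul],
    setIntegral_Ioc_comp_primitive hm hr hM (hT.antitone_tail _).measurable]
  · apply setIntegral_congr_ae measurableSet_Ioc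
    filter_upwards [ae_eq_zero_or_primitive_lt hm hr] with x hx _
    rcases hx with hx | hx
    · rw [hx, mul_zero, mul_zero]
    · congr 5
      ext ω
      exact ⟨fun hω => hmono.reflect_lt hω, fun hω => hx _ hω⟩

/-- Cash additivity of the Choquet integral of a nonnegative bounded variable. -/
theorem choquet_eq_add_integral_tail {T : ℝ → ℝ} (hT : IsDistortion T) {Z W : Ω → ℝ} {c K : ℝ}
    (hZ : Z =ᵐ[μ] fun ω => W ω + c) (hK : 0 ≤ K) (hW : ∀ᵐ ω ∂μ, 0 ≤ W ω ∧ W ω ≤ K) :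
    choquet μ T Z = c + ∫ t in Set.Ioi (0:ℝ), T (μ {ω | t < W ω}).toReal := by
  set G : ℝ → ℝ := fun t => T (μ {ω | t < Z ω}).toReal with hG
  have hGa : Antitone G := hT.antitone_tail Z
  have hGi : ∀ a b, IntervalIntegrable G volume a b := fun a b => hGa.intervalIntegrable
  have hG1 : ∀ t < c, G t = 1 := fun t ht => hT.tail_eq_one (by
    filter_upwards [hZ, hW] with ω h1 h2
    linarith [h2.1])
  have hG0 : ∀ t, c + K ≤ t → G t = 0 := fun t ht => hT.tail_eq_zero (by
    filter_upwards [hZ, hW] with ω h1 h2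
    linarith [h2.2])
  have hshift : ∀ t, T (μ {ω | t < W ω}).toReal = G (t + c) := fun t => by
    have : μ {ω | t < W ω} = μ {ω | t + c < Z ω} := by
      apply measure_congr
      filter_upwards [hZ] with ω h1
      apply propext
      change t < W ω ↔ t + c < Z ω
      rw [h1, add_lt_add_iff_right]
    rw [this]
  set A := min 0 c - 1 with hA
  set B := max 0 (c + K) with hB
  have hA0 : A ≤ 0 := by linarith [min_le_left 0 c]
  have hAc : A < c := by linarith [min_le_right 0 c]
  have hB0 : 0 ≤ B := le_max_left _ _
  have hBK : c + K ≤ B := le_max_right _ _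
  have e1 : ∫ t in Set.Ioi (0:ℝ), G t = ∫ t in (0:ℝ)..B, G t := by
    rw [intervalIntegral.integral_of_le hB0]
    exact setIntegral_Ioi_eq_setIntegral_Ioc fun x hx => hG0 x (hBK.trans hx.le)
  have e2 : ∫ t in Set.Iio (0:ℝ), (G t - 1) = (∫ t in A..(0:ℝ), G t) + A := by
    rw [← integral_Iic_eq_integral_Iio]
    have : ∫ t in Set.Iic (0:ℝ), (G t - 1) = ∫ t in A..(0:ℝ), (G t - 1) := by
      rw [intervalIntegral.integral_of_le hA0]
      refine setIntegral_eq_of_subset_of_forall_sdiff_eq_zero measurableSet_Iic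
        Set.Ioc_subset_Iic_self ?_
      rintro x ⟨hx0, hx⟩
      rw [hG1 x, sub_self]
      by_contra! hlt
      exact hx ⟨hAc.trans_le hlt, hx0⟩
    rw [this, intervalIntegral.integral_sub (hGi _ _) intervalIntegrable_const]
    simp
  have e3 : ∫ t in Set.Ioi (0:ℝ), T (μ {ω | t < W ω}).toReal = ∫ t in c..(c + K), G t := by
    simp_rw [hshift]
    have : ∫ t in Set.Ioi (0:ℝ), G (t + c) = ∫ t in (0:ℝ)..K, G (t + c) := by
      rw [intervalIntegral.integral_of_le hK]
      exact setIntegral_Ioi_eq_setIntegral_Ioc fun x hx => hG0 _ (by linarith)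
    rw [this, intervalIntegral.integral_comp_add_right, zero_add, add_comm K]
  have e4 : ∫ t in A..c, G t = c - A := by
    rw [intervalIntegral.integral_of_le hAc.le, integral_Ioc_eq_integral_Ioo,
      setIntegral_congr_fun measurableSet_Ioo (g := fun _ => (1:ℝ)) fun t ht => hG1 t ht.2]
    simp [hAc.le]
  have e5 : ∫ t in (c + K)..B, G t = 0 := by
    rw [intervalIntegral.integral_congr (g := fun _ => (0:ℝ))]
    · simp
    · intro t ht
      rw [Set.uIcc_of_le hBK] at ht
      exact hG0 t ht.1
  have s1 := intervalIntegral.integral_add_adjacent_intervals (hGi A 0) (hGi 0 B)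
  have s2 := intervalIntegral.integral_add_adjacent_intervals (hGi A c) (hGi c (c + K))
  have s3 := intervalIntegral.integral_add_adjacent_intervals (hGi A (c + K)) (hGi (c + K) B)
  rw [e3]
  change (∫ t in Set.Ioi (0:ℝ), G t) + ∫ t in Set.Iio (0:ℝ), (G t - 1) = _
  rw [e1, e2]
  linarith

/-- The dual utility of `g (V) + c`, where `g` is the primitive of `h`. -/
theorem choquet_primitive_add {T : ℝ → ℝ} (hT : IsDistortion T) {h : ℝ → ℝ} (hm : Measurable h)
    (hr : ∀ x, h x ∈ Set.Icc (0:ℝ) 1) {V Z : Ω → ℝ} {c M : ℝ} (hM : 0 ≤ M)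
    (hV : ∀ᵐ ω ∂μ, 0 ≤ V ω ∧ V ω ≤ M)
    (hZ : Z =ᵐ[μ] fun ω => (∫ z in (0:ℝ)..V ω, h z) + c) :
    choquet μ T Z = c + ∫ x in Set.Ioi (0:ℝ), T (μ {ω | x < V ω}).toReal * h x := by
  have hmono := monotone_primitive hm hr
  have h0 : ∫ z in (0:ℝ)..0, h z = 0 := intervalIntegral.integral_same
  rw [choquet_eq_add_integral_tail hT hZ (K := ∫ z in (0:ℝ)..M, h z)
    (h0.symm.le.trans (hmono hM)) (hV.mono fun ω hω => ⟨h0.symm.le.trans (hmono hω.1), hmono hω.2⟩),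
    integral_tail_primitive hT hm hr hM (hV.mono fun ω hω => hω.2)]

/-- A function of `w` with increments between `0` and those of `w` extends to the whole line. -/
theorem exists_monotone_extension {ι : Type*} (w f : ι → ℝ)
    (hf : ∀ a b, w a ≤ w b → f a ≤ f b ∧ f b - f a ≤ w b - w a) :
    ∃ F : ℝ → ℝ, Monotone F ∧ Monotone (fun x => x - F x) ∧ ∀ a, f a = F (w a) := by
  set φ : ι → ℝ := fun a => 2 * f a - w a with hφ
  have hfac : Function.FactorsThrough φ w := fun a b hab => by
    have h1 := hf a b hab.le
    have h2 := hf b a hab.ge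
    simp only [hφ]
    linarith
  have hlip : LipschitzOnWith 1 (Function.extend w φ 0) (Set.range w) := by
    apply LipschitzOnWith.of_dist_le_mul
    rintro _ ⟨a, rfl⟩ _ ⟨b, rfl⟩
    rw [hfac.extend_apply, hfac.extend_apply, NNReal.coe_one, one_mul, Real.dist_eq, Real.dist_eq,
      abs_le]
    simp only [hφ]
    rcases le_total (w a) (w b) with hab | hab
    · have h1 := hf a b hab
      rw [abs_of_nonpos (sub_nonpos.2 hab)]
      constructor <;> linarith
    · have h1 := hf b a hab
      rw [abs_of_nonneg (sub_nonneg.2 hab)]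
      constructor <;> linarith
  obtain ⟨E, hE, hEq⟩ := hlip.extend_real
  have hE' : ∀ x y, x ≤ y → |E x - E y| ≤ y - x := fun x y hxy => by
    have := hE.dist_le_mul x y
    rwa [NNReal.coe_one, one_mul, Real.dist_eq, Real.dist_eq, abs_sub_comm x,
      abs_of_nonneg (sub_nonneg.2 hxy)] at this
  refine ⟨fun x => (E x + x) / 2, fun x y hxy => ?_, fun x y hxy => ?_, fun a => ?_⟩
  · have := abs_le.1 (hE' x y hxy)
    dsimp only
    linarith
  · have := abs_le.1 (hE' x y hxy)
    dsimp only
    linarith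
  · dsimp only
    rw [← hEq ⟨a, rfl⟩, hfac.extend_apply]
    simp [hφ]

theorem ComonotoneFun.le_of_sum_le {α : Type*} {n : ℕ} {Z : Fin n → α → ℝ} (hZ : ComonotoneFun Z)
    {a b : α} (hab : ∑ j, Z j a ≤ ∑ j, Z j b) (i : Fin n) : Z i a ≤ Z i b := by
  by_contra! hlt
  refine absurd hab (not_le.2 (Finset.sum_lt_sum (fun j _ => ?_) ⟨i, Finset.mem_univ i, hlt⟩))
  have := nonneg_of_mul_nonneg_right (hZ i j a b) (sub_pos.2 hlt)
  linarith

/-- Comonotone variables are nondecreasing functions of their sum, and these functions can be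
chosen on the whole line so as to sum to the identity. -/
theorem ComonotoneFun.exists_monotone {α : Type*} {n : ℕ} {Z : Fin (n + 1) → α → ℝ}
    (hZ : ComonotoneFun Z) :
    ∃ F : Fin (n + 1) → ℝ → ℝ, (∀ i, Monotone (F i)) ∧ (∀ x, ∑ i, F i x = x) ∧
      ∀ i ω, Z i ω = F i (∑ j, Z j ω) := by
  induction n with
  | zero =>
    refine ⟨fun _ x => x, fun _ => monotone_id, fun x => by simp, fun i ω => ?_⟩
    rw [Fin.fin_one_eq_zero i, Fin.sum_univ_one]
  | succ n ih =>
    obtain ⟨F₀, hF₀, hF₀', hZ₀⟩ := exists_monotone_extension (fun ω => ∑ j, Z j ω) (Z 0)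
      fun a b hab => ⟨hZ.le_of_sum_le hab 0, by
        rw [← Finset.sum_sub_distrib]
        exact Finset.single_le_sum (f := fun j => Z j b - Z j a)
          (fun j _ => sub_nonneg.2 (hZ.le_of_sum_le hab j)) (Finset.mem_univ 0)⟩
    obtain ⟨F, hF, hsum, hZF⟩ := ih (Z := fun i => Z i.succ) fun i j => hZ i.succ j.succ
    refine ⟨Fin.cons F₀ fun i x => F i (x - F₀ x), fun i => ?_, fun x => ?_, fun i ω => ?_⟩
    · refine Fin.cases hF₀ (fun i => ?_) i
      exact (hF i).comp hF₀'
    · simp [Fin.sum_univ_succ, hsum]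
    · refine Fin.cases ?_ (fun i => ?_) i
      · simpa using hZ₀ ω
      · rw [Fin.cons_succ, ← hZ₀ ω, Fin.sum_univ_succ, add_sub_cancel_left]
        exact hZF i ω

/-- Nondecreasing functions summing to a translation are primitives of densities summing to one. -/
theorem Monotone.exists_density {n : ℕ} {F : Fin n → ℝ → ℝ} {s : ℝ} (hF : ∀ i, Monotone (F i))
    (hsum : ∀ x, ∑ i, F i x = x + s) :
    ∃ h : Fin n → ℝ → ℝ, (∀ i, Measurable (h i)) ∧ (∀ i x, h i x ∈ Set.Icc (0:ℝ) 1) ∧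
      (∀ᵐ x, ∑ i, h i x = 1) ∧ ∀ i x, F i x = (∫ z in (0:ℝ)..x, h i z) + F i 0 := by
  have hlip : ∀ i, LipschitzWith 1 (F i) := fun i => by
    apply LipschitzWith.of_le_add
    intro x y
    rcases le_total x y with hxy | hxy
    · exact (hF i hxy).trans (le_add_of_nonneg_right dist_nonneg)
    · have := Finset.single_le_sum (f := fun j => F j x - F j y)
        (fun j _ => sub_nonneg.2 (hF j hxy)) (Finset.mem_univ i)
      rw [Finset.sum_sub_distrib, hsum, hsum] at this
      rw [Real.dist_eq, abs_of_nonneg (sub_nonneg.2 hxy)]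
      linarith
  refine ⟨fun i => deriv (F i), fun i => measurable_deriv _, fun i x => ⟨(hF i).deriv_nonneg, ?_⟩,
    ?_, fun i x => ?_⟩
  · have := norm_deriv_le_of_lipschitz (x₀ := x) (hlip i)
    rw [Real.norm_eq_abs, NNReal.coe_one] at this
    exact (le_abs_self _).trans this
  · have hd : ∀ᵐ x, ∀ i, DifferentiableAt ℝ (F i) x :=
      ae_all_iff.2 fun i => (hlip i).ae_differentiableAt_real
    filter_upwards [hd] with x hx
    rw [← deriv_fun_sum fun i _ => hx i]
    simp [hsum]
  · rw [((hlip i).lipschitzOnWith.absolutelyContinuousOnInterval).integral_deriv_eq_sub]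
    ring

/-- Comonotone allocations are given by densities and constants. -/
theorem ComonotoneLp.exists_density {ν : Measure Ω} {n : ℕ} (hn : 0 < n) {Y : Fin n → Xinf ν}
    (hY : ComonotoneLp Y) {S : Ω → ℝ} (hS : S =ᵐ[ν] fun ω => ∑ i, Y i ω) (s : ℝ) :
    ∃ h : Fin n → ℝ → ℝ, (∀ i, Measurable (h i)) ∧ (∀ i x, h i x ∈ Set.Icc (0:ℝ) 1) ∧
      (∀ᵐ x, ∑ i, h i x = 1) ∧ ∃ c : Fin n → ℝ, ∑ i, c i = s ∧
        ∀ i, (Y i : Ω → ℝ) =ᵐ[ν] fun ω => (∫ z in (0:ℝ)..(S ω - s), h i z) + c i := by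
  obtain ⟨n, rfl⟩ : ∃ m, n = m + 1 := ⟨n - 1, by omega⟩
  obtain ⟨Z, hYZ, hZ⟩ := hY
  obtain ⟨F, hF, hsum, hZF⟩ := hZ.exists_monotone
  obtain ⟨h, hm, hr, h1, hFh⟩ := Monotone.exists_density (F := fun i x => F i (x + s))
    (fun i x y hxy => hF i (by linarith)) fun x => hsum (x + s)
  refine ⟨h, hm, hr, h1, fun i => F i s, hsum s, fun i => ?_⟩
  filter_upwards [hYZ i, hS, ae_all_iff.2 hYZ] with ω e1 e2 e3
  have := hFh i (S ω - s)
  simp only [sub_add_cancel, zero_add] at this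
  rw [e1, hZF, ← Finset.sum_congr rfl fun j _ => e3 j, ← e2]
  linarith

theorem ae_abs_le_Lp_top {ν : Measure Ω} (S : Xinf ν) : ∃ C : ℝ, ∀ᵐ ω ∂ν, |S ω| ≤ C := by
  refine ⟨(eLpNormEssSup S ν).toReal, ?_⟩
  have hfin : eLpNormEssSup S ν ≠ ⊤ := by
    simpa using (Lp.memLp S).eLpNorm_ne_top
  filter_upwards [ae_le_eLpNormEssSup (f := S) (μ := ν)] with ω hω
  have := ENNReal.toReal_mono hfin hω
  simpa using this

theorem ae_essInfS_le {ν : Measure Ω} (S : Xinf ν) : ∃ M : ℝ, 0 ≤ M ∧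
    ∀ᵐ ω ∂ν, 0 ≤ S ω - essInfS S ∧ S ω - essInfS S ≤ M := by
  obtain ⟨C, hC⟩ := ae_abs_le_Lp_top S
  have hbdd : IsBoundedUnder (· ≥ ·) (ae ν) (S : Ω → ℝ) :=
    ⟨-C, hC.mono fun ω hω => (abs_le.1 hω).1⟩
  refine ⟨max 0 (C - essInfS S), le_max_left _ _, ?_⟩
  filter_upwards [hC, ae_essInf_le hbdd] with ω h1 h2
  refine ⟨sub_nonneg.2 h2, le_max_of_le_right ?_⟩
  linarith [(abs_le.1 h1).2]

theorem setOf_lt_sub_essInfS {ν : Measure Ω} (S : Xinf ν) (x : ℝ) :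
    (ν {ω | x < S ω - essInfS S}).toReal = tailProbS S x := by
  simp only [tailProbS, lt_sub_iff_add_lt']

theorem IsDistortion.antitone_tailProbS {T : ℝ → ℝ} (hT : IsDistortion T) (S : Xinf μ) :
    Antitone fun x => T (tailProbS S x) := by
  simp_rw [← setOf_lt_sub_essInfS]
  exact hT.antitone_tail _

theorem IsDistortion.mem_Icc_tailProbS {T : ℝ → ℝ} (hT : IsDistortion T) (S : Xinf μ) (x : ℝ) :
    T (tailProbS S x) ∈ Set.Icc (0:ℝ) 1 :=
  hT.2.1 _ (toReal_measure_mem_Icc _)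

/-- Bounded measurable functions vanishing beyond some point are integrable on the half line. -/
theorem integrableOn_Ioi_of_mem_Icc {f : ℝ → ℝ} (hf : Measurable f)
    (hr : ∀ x, f x ∈ Set.Icc (0:ℝ) 1) {M : ℝ} (h0 : ∀ x, M < x → f x = 0) :
    IntegrableOn f (Set.Ioi 0) := by
  have h1 : IntegrableOn f (Set.Ioc 0 M) := (intervalIntegrable_of_mem_Icc hf hr 0 M).1
  refine h1.of_forall_sdiff_eq_zero measurableSet_Ioi ?_
  rintro x ⟨hx0, hx⟩
  exact h0 x (lt_of_not_ge fun hle => hx ⟨hx0, hle⟩)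

section DualUtility

variable {n : ℕ} {T : Fin n → ℝ → ℝ} {h : Fin n → ℝ → ℝ}

theorem exists_tailProbS_eq_zero {ν : Measure Ω} (S : Xinf ν) (hT : ∀ i, IsDistortion (T i)) :
    ∃ M : ℝ, ∀ i x, M < x → T i (tailProbS S x) = 0 := by
  obtain ⟨M, -, hM⟩ := ae_essInfS_le S
  refine ⟨M, fun i x hx => ?_⟩
  rw [← setOf_lt_sub_essInfS]
  exact (hT i).tail_eq_zero (hM.mono fun ω hω => hω.2.trans hx.le)

theorem le_iSup_tailProbS {ν : Measure Ω} (S : Xinf ν) (i : Fin n) (x : ℝ) :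
    T i (tailProbS S x) ≤ ⨆ j, T j (tailProbS S x) :=
  le_ciSup (f := fun j => T j (tailProbS S x)) (Set.finite_range _).bddAbove i

theorem integrableOn_iSup_tailProbS (S : Xinf μ) (hT : ∀ i, IsDistortion (T i)) :
    IntegrableOn (fun x => ⨆ j, T j (tailProbS S x)) (Set.Ioi 0) := by
  obtain ⟨M, hM⟩ := exists_tailProbS_eq_zero S hT
  refine integrableOn_Ioi_of_mem_Icc
    (Measurable.iSup fun i => ((hT i).antitone_tailProbS S).measurable)
    (fun x => ⟨Real.iSup_nonneg fun i => ((hT i).mem_Icc_tailProbS S x).1,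
      Real.iSup_le (fun i => ((hT i).mem_Icc_tailProbS S x).2) zero_le_one⟩)
    (M := M) fun x hx => ?_
  simp [hM _ x hx]

theorem integrableOn_tailProbS_mul (S : Xinf μ) (hT : ∀ i, IsDistortion (T i))
    (hm : ∀ i, Measurable (h i)) (hr : ∀ i x, h i x ∈ Set.Icc (0:ℝ) 1) (i : Fin n) :
    IntegrableOn (fun x => T i (tailProbS S x) * h i x) (Set.Ioi 0) := by
  obtain ⟨M, hM⟩ := exists_tailProbS_eq_zero S hT
  refine integrableOn_Ioi_of_mem_Icc (((hT i).antitone_tailProbS S).measurable.mul (hm i))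
    (fun x => ?_) (M := M) fun x hx => by rw [hM i x hx, zero_mul]
  have h1 := (hT i).mem_Icc_tailProbS S x
  exact ⟨mul_nonneg h1.1 (hr i x).1, mul_le_one₀ h1.2 (hr i x).1 (hr i x).2⟩

/-- The total dual utility of an allocation given by densities and constants. -/
theorem sum_choquetLp_eq (S : Xinf μ) (hT : ∀ i, IsDistortion (T i))
    (hm : ∀ i, Measurable (h i)) (hr : ∀ i x, h i x ∈ Set.Icc (0:ℝ) 1) {c : Fin n → ℝ}
    (hc : ∑ i, c i = essInfS S) {Y : Fin n → Xinf μ}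
    (hY : ∀ i, (Y i : Ω → ℝ) =ᵐ[μ]
      fun ω => (∫ z in (0:ℝ)..(S ω - essInfS S), h i z) + c i) :
    ∑ i, choquetLp μ (T i) (Y i) =
      essInfS S + ∫ x in Set.Ioi (0:ℝ), ∑ i, T i (tailProbS S x) * h i x := by
  obtain ⟨M, hM, hSM⟩ := ae_essInfS_le S
  rw [integral_finsetSum _ fun i _ => integrableOn_tailProbS_mul S hT hm hr i, ← hc,
    ← Finset.sum_add_distrib]
  refine Finset.sum_congr rfl fun i _ => ?_
  rw [choquetLp, choquet_primitive_add (hT i) (hm i) (hr i) hM hSM (hY i)]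
  simp_rw [setOf_lt_sub_essInfS]

/-- Densities supported on the maximizing agents attain the pointwise maximum. -/
theorem sum_mul_eq_iSup {ν : Measure Ω} {S : Xinf ν} {x : ℝ} {p : Fin n → ℝ} (hp : ∀ i, 0 ≤ p i)
    (h1 : ∑ i ∈ Lset S T x, p i = 1) (h0 : ∑ i ∈ (Lset S T x)ᶜ, p i = 0) :
    ∑ i, T i (tailProbS S x) * p i = ⨆ j, T j (tailProbS S x) := by
  have hz := (Finset.sum_eq_zero_iff_of_nonneg fun i _ => hp i).1 h0
  rw [← Finset.sum_add_sum_compl (Lset S T x),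
    Finset.sum_congr rfl (g := fun i => (⨆ j, T j (tailProbS S x)) * p i) fun i hi => by
      rw [(Finset.mem_filter.1 hi).2],
    Finset.sum_eq_zero (s := (Lset S T x)ᶜ) fun i hi => by rw [hz i hi, mul_zero],
    ← Finset.mul_sum, h1, mul_one, add_zero]

theorem sum_mul_le_iSup {ν : Measure Ω} {S : Xinf ν} {x : ℝ} {p : Fin n → ℝ} (hp : ∀ i, 0 ≤ p i)
    (h1 : ∑ i, p i = 1) :
    ∑ i, T i (tailProbS S x) * p i ≤ ⨆ j, T j (tailProbS S x) := by
  calc ∑ i, T i (tailProbS S x) * p i ≤ ∑ i, (⨆ j, T j (tailProbS S x)) * p i :=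
        Finset.sum_le_sum fun i _ => mul_le_mul_of_nonneg_right (le_iSup_tailProbS S i x) (hp i)
    _ = ⨆ j, T j (tailProbS S x) := by rw [← Finset.mul_sum, h1, mul_one]

/-- Densities attaining the pointwise maximum are supported on the maximizing agents. -/
theorem sum_Lset_of_sum_mul_eq_iSup {ν : Measure Ω} {S : Xinf ν} {x : ℝ} {p : Fin n → ℝ} (hp : ∀ i, 0 ≤ p i)
    (h1 : ∑ i, p i = 1)
    (heq : ∑ i, T i (tailProbS S x) * p i = ⨆ j, T j (tailProbS S x)) :
    ∑ i ∈ Lset S T x, p i = 1 ∧ ∑ i ∈ (Lset S T x)ᶜ, p i = 0 := by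
  have hsum : ∑ i, ((⨆ j, T j (tailProbS S x)) - T i (tailProbS S x)) * p i = 0 := by
    simp_rw [sub_mul]
    rw [Finset.sum_sub_distrib, ← Finset.mul_sum, h1, heq, mul_one, sub_self]
  have hz := (Finset.sum_eq_zero_iff_of_nonneg fun i _ =>
    mul_nonneg (sub_nonneg.2 (le_iSup_tailProbS S i x)) (hp i)).1 hsum
  have h0 : ∑ i ∈ (Lset S T x)ᶜ, p i = 0 := by
    refine Finset.sum_eq_zero fun i hi => ?_
    refine (mul_eq_zero.1 (hz i (Finset.mem_univ i))).resolve_left fun hi' => ?_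
    rw [Finset.mem_compl] at hi
    exact hi (Finset.mem_filter.2 ⟨Finset.mem_univ i, (sub_eq_zero.1 hi').symm⟩)
  refine ⟨?_, h0⟩
  rw [← h1, ← Finset.sum_add_sum_compl (Lset S T x), h0, add_zero]

/-- Allocations given by densities supported on the maximizing agents attain the bound. -/
theorem sum_choquetLp_eq_JobjS (S : Xinf μ) (hT : ∀ i, IsDistortion (T i))
    (hm : ∀ i, Measurable (h i)) (hr : ∀ i x, h i x ∈ Set.Icc (0:ℝ) 1)
    (hae : ∀ᵐ x ∂(volume.restrict (Set.Ici (0:ℝ))),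
      (∑ i ∈ Lset S T x, h i x) = 1 ∧ ∑ i ∈ (Lset S T x)ᶜ, h i x = 0)
    {c : Fin n → ℝ} (hc : ∑ i, c i = essInfS S) {Y : Fin n → Xinf μ}
    (hY : ∀ i, (Y i : Ω → ℝ) =ᵐ[μ]
      fun ω => (∫ z in (0:ℝ)..(S ω - essInfS S), h i z) + c i) :
    ∑ i, choquetLp μ (T i) (Y i) = essInfS S + JobjS S T := by
  rw [← restrict_Ioi_eq_restrict_Ici] at hae
  rw [sum_choquetLp_eq S hT hm hr hc hY, JobjS]
  congr 1
  apply integral_congr_ae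
  filter_upwards [hae] with x hx
  exact sum_mul_eq_iSup (fun i => (hr i x).1) hx.1 hx.2

/-- The total dual utility of comonotone allocations is bounded, and the bound is attained only by
allocations given by densities supported on the maximizing agents. -/
theorem ComonotoneLp.sum_choquetLp_le (hn : 0 < n) (S : Xinf μ) (hT : ∀ i, IsDistortion (T i))
    {Y : Fin n → Xinf μ} (hY : ComonotoneLp Y) (hYS : ∑ i, Y i = S) :
    ∑ i, choquetLp μ (T i) (Y i) ≤ essInfS S + JobjS S T ∧
      (∑ i, choquetLp μ (T i) (Y i) = essInfS S + JobjS S T →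
        ∃ h : Fin n → ℝ → ℝ, (∀ i, Measurable (h i)) ∧
          (∀ i x, h i x ∈ Set.Icc (0:ℝ) 1) ∧
          (∀ᵐ x ∂(volume.restrict (Set.Ici (0:ℝ))),
            (∑ i ∈ Lset S T x, h i x) = 1 ∧ ∑ i ∈ (Lset S T x)ᶜ, h i x = 0) ∧
          ∃ c : Fin n → ℝ, ∑ i, c i = essInfS S ∧
            ∀ i, (Y i : Ω → ℝ) =ᵐ[μ]
              fun ω => (∫ z in (0:ℝ)..(S ω - essInfS S), h i z) + c i) := by
  have hS : (S : Ω → ℝ) =ᵐ[μ] fun ω => ∑ i, Y i ω := by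
    rw [← hYS]
    exact Lp.coeFn_fun_finsetSum Finset.univ Y
  obtain ⟨h, hm, hr, h1, c, hc, hYh⟩ := hY.exists_density hn hS (essInfS S)
  have hle : (fun x => ∑ i, T i (tailProbS S x) * h i x)
      ≤ᵐ[volume.restrict (Set.Ioi 0)] fun x => ⨆ j, T j (tailProbS S x) := by
    filter_upwards [ae_restrict_of_ae h1] with x hx
    exact sum_mul_le_iSup (fun i => (hr i x).1) hx
  have hi1 := integrable_finsetSum (μ := volume.restrict (Set.Ioi 0)) Finset.univ
    fun i _ => integrableOn_tailProbS_mul S hT hm hr i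
  have hi2 := integrableOn_iSup_tailProbS S hT
  rw [sum_choquetLp_eq S hT hm hr hc hYh, JobjS]
  refine ⟨add_le_add_right (integral_mono_ae hi1 hi2 hle) _, fun heq => ?_⟩
  refine ⟨h, hm, hr, ?_, c, hc, hYh⟩
  rw [← restrict_Ioi_eq_restrict_Ici]
  filter_upwards [(integral_eq_iff_of_ae_le hi1 hi2 hle).1 (add_left_cancel heq),
    ae_restrict_of_ae h1] with x hx hx1
  exact sum_Lset_of_sum_mul_eq_iSup (fun i => (hr i x).1) hx1 hx

theorem comonotoneLp_primitive {ν : Measure Ω} {V : Ω → ℝ} (hm : ∀ i, Measurable (h i))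
    (hr : ∀ i x, h i x ∈ Set.Icc (0:ℝ) 1) {c : Fin n → ℝ} {Y : Fin n → Xinf ν}
    (hY : ∀ i, (Y i : Ω → ℝ) =ᵐ[ν] fun ω => (∫ z in (0:ℝ)..V ω, h i z) + c i) :
    ComonotoneLp Y := by
  refine ⟨_, hY, fun i j a b => ?_⟩
  simp only [add_sub_add_right_eq_sub]
  rcases le_total (V a) (V b) with hab | hab
  · exact mul_nonneg_of_nonpos_of_nonpos
      (sub_nonpos.2 (monotone_primitive (hm i) (hr i) hab))
      (sub_nonpos.2 (monotone_primitive (hm j) (hr j) hab))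
  · exact mul_nonneg (sub_nonneg.2 (monotone_primitive (hm i) (hr i) hab))
      (sub_nonneg.2 (monotone_primitive (hm j) (hr j) hab))

end DualUtility

/-- Closed-form characterization of comonotone Pareto optima for concave dual
(Yaari) utilities given by convex distortion functions. -/
theorem dual_utility_cpo_characterization
    (hatomless : AtomlessMeasure μ) {n : ℕ} (hn : 0 < n)
    (U : Fin n → Xinf μ → ℝ) (X : Fin n → Xinf μ)
    (S : Xinf μ) (hS : S = ∑ i, X i)
    (T : Fin n → ℝ → ℝ) (hT : ∀ i, IsConvexDistortion (T i))
    (hU : ∀ i (Z : Xinf μ), U i Z = choquetLp μ (T i) Z)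
    (h : Fin n → ℝ → ℝ) (hmeas : ∀ i, Measurable (h i))
    (hrange : ∀ i x, h i x ∈ Set.Icc (0:ℝ) 1)
    (hae : ∀ᵐ x ∂(volume.restrict (Set.Ici (0:ℝ))),
      (∑ i ∈ Lset S T x, h i x) = 1 ∧ ∑ i ∈ (Lset S T x)ᶜ, h i x = 0)
    (c : Fin n → ℝ) (hc : ∑ i, c i = essInfS S)
    (Ystar : Fin n → Xinf μ)
    (hYstar : ∀ i, (Ystar i : Ω → ℝ) =ᵐ[μ]
      fun ω => (∫ z in (0:ℝ)..(S ω - essInfS S), h i z) + c i)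
    (hIR : Ystar ∈ IRset U X) :
    (sSup {r : ℝ | ∃ Y ∈ IRset U X, ComonotoneLp Y ∧ r = ∑ i, U i (Y i)} =
        ∑ i, U i (Ystar i)) ∧
    (∑ i, U i (Ystar i) = essInfS S + JobjS S T) ∧
    Ystar ∈ CPOset U X ∧
    (∀ Y ∈ IRset U X, ComonotoneLp Y →
      (∀ Y' ∈ IRset U X, ComonotoneLp Y' → ∑ i, U i (Y' i) ≤ ∑ i, U i (Y i)) →
      ∃ h' : Fin n → ℝ → ℝ, (∀ i, Measurable (h' i)) ∧
        (∀ i x, h' i x ∈ Set.Icc (0:ℝ) 1) ∧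
        (∀ᵐ x ∂(volume.restrict (Set.Ici (0:ℝ))),
          (∑ i ∈ Lset S T x, h' i x) = 1 ∧ ∑ i ∈ (Lset S T x)ᶜ, h' i x = 0) ∧
        ∃ c' : Fin n → ℝ, ∑ i, c' i = essInfS S ∧
          ∀ i, (Y i : Ω → ℝ) =ᵐ[μ]
            fun ω => (∫ z in (0:ℝ)..(S ω - essInfS S), h' i z) + c' i) := by
  subst hS
  have hD : ∀ i, IsDistortion (T i) := fun i => (hT i).1
  obtain rfl : U = fun i Z => choquetLp μ (T i) Z := funext fun i => funext (hU i)
  have hval := sum_choquetLp_eq_JobjS _ hD hmeas hrange hae hc hYstar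
  have hcom : ComonotoneLp Ystar := comonotoneLp_primitive hmeas hrange hYstar
  have hbound : ∀ Y ∈ IRset (fun i Z => choquetLp μ (T i) Z) X, ComonotoneLp Y →
      ∑ i, choquetLp μ (T i) (Y i) ≤ ∑ i, choquetLp μ (T i) (Ystar i) := fun Y hY hYc =>
    hval ▸ (hYc.sum_choquetLp_le hn _ hD hY.1).1
  refine ⟨?_, hval, ⟨hIR, hcom, ?_⟩, fun Y hY hYc hmax => ?_⟩
  · refine IsGreatest.csSup_eq ⟨⟨Ystar, hIR, hcom, rfl⟩, ?_⟩
    rintro _ ⟨Y, hY, hYc, rfl⟩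
    exact hbound Y hY hYc
  · rintro ⟨Y, hY, hYc, hle, j, hlt⟩
    exact (hbound Y hY hYc).not_gt
      (Finset.sum_lt_sum (fun i _ => hle i) ⟨j, Finset.mem_univ j, hlt⟩)
  · exact (hYc.sum_choquetLp_le hn _ hD hY.1).2
      (((hbound Y hY hYc).antisymm (hmax Ystar hIR hcom)).trans hval)

end
end
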